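/- There exist absolute constants c, C > 0 such that the following holds. If σ ≤ c·(σ_min(A)/κ⁴)·√n/(√d·(√(nd)+√m+√(2γ n log n))), then with probability at least 1 − C·n^{−γ+2} the GPM limit S^∞ satisfies the blockwise error bound min_{Q∈O(d)} max_{1≤i≤n} ‖S_i^∞ − Q‖_F ≤ C·(κ²/‖A‖)·σ√d·(√(nd)+√m+√(2γ n log n))/√n, where S_i^∞ is the i-th d×d block of S^∞ and ‖A‖ is the operator norm. -/

import Mathlib

open MeasureTheory Matrix Filter

namespace GOPP

/-- Frobenius norm of a real matrix. -/
noncomputable def frob {α β : Type*} [Fintype α] [Fintype β] (X : Matrix α β ℝ) : ℝ :=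
  Real.sqrt (∑ i, ∑ j, X i j ^ 2)

/-- Euclidean norm of a vector. -/
noncomputable def vnorm {β : Type*} [Fintype β] (v : β → ℝ) : ℝ :=
  Real.sqrt (∑ j, v j ^ 2)

/-- Operator (spectral) norm: the supremum of ‖Xu‖ over unit vectors u. -/
noncomputable def opNorm {α β : Type*} [Fintype α] [Fintype β] (X : Matrix α β ℝ) : ℝ :=
  sSup {r : ℝ | ∃ u : β → ℝ, vnorm u = 1 ∧ r = vnorm (X.mulVec u)}

/-- Smallest singular value: the infimum of ‖uᵀX‖ over unit vectors u (for a d×m matrix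
with d ≤ m this is the d-th largest singular value; for square matrices it is σ_min). -/
noncomputable def sigmaMin {α β : Type*} [Fintype α] [Fintype β] (X : Matrix α β ℝ) : ℝ :=
  sInf {r : ℝ | ∃ u : α → ℝ, vnorm u = 1 ∧ r = vnorm (Matrix.vecMul u X)}

/-- Condition number κ = σ_max/σ_min. -/
noncomputable def kappa {d m : ℕ} (A : Matrix (Fin d) (Fin m) ℝ) : ℝ :=
  opNorm A / sigmaMin A

/-- Q is an orthogonal matrix. -/
def IsOrth {d : ℕ} (Q : Matrix (Fin d) (Fin d) ℝ) : Prop :=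
  Qᵀ * Q = 1 ∧ Q * Qᵀ = 1

/-- Nuclear norm, via the dual characterization ‖M‖_* = max_{Q ∈ O(d)} ⟨Q, M⟩. -/
noncomputable def nuclearNorm {d : ℕ} (M : Matrix (Fin d) (Fin d) ℝ) : ℝ :=
  sSup {r : ℝ | ∃ Q : Matrix (Fin d) (Fin d) ℝ, IsOrth Q ∧ r = Matrix.trace (Qᵀ * M)}

/-- The i-th d×k block of an (nd)×k block matrix. -/
def blk {n d k : ℕ} (S : Matrix (Fin n × Fin d) (Fin k) ℝ) (i : Fin n) :
    Matrix (Fin d) (Fin k) ℝ :=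
  Matrix.of fun a b => S (i, a) b

/-- The i-th diagonal d×d block of an (nd)×(nd) matrix. -/
def dblk {n d : ℕ} (G : Matrix (Fin n × Fin d) (Fin n × Fin d) ℝ) (i : Fin n) :
    Matrix (Fin d) (Fin d) ℝ :=
  Matrix.of fun a b => G (i, a) (i, b)

/-- S ∈ O(d)^{⊗n}: each of the n d×d blocks of S is orthogonal. -/
def OrthBlocks {n d : ℕ} (S : Matrix (Fin n × Fin d) (Fin d) ℝ) : Prop :=
  ∀ i, IsOrth (blk S i)

/-- Z ∈ ℝ^{nd×d}: the vertical stack of n copies of I_d. -/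
def ZStack (n d : ℕ) : Matrix (Fin n × Fin d) (Fin d) ℝ :=
  Matrix.of fun p j => if p.2 = j then 1 else 0

/-- Vertical stack of n given d×k matrices. -/
def stack {n d k : ℕ} (B : Fin n → Matrix (Fin d) (Fin k) ℝ) :
    Matrix (Fin n × Fin d) (Fin k) ℝ :=
  Matrix.of fun p b => B p.1 p.2 b

/-- d_F(X,Y) = min_{Q ∈ O(d)} ‖X − YQ‖_F. -/
noncomputable def dF {n d : ℕ} (X Y : Matrix (Fin n × Fin d) (Fin d) ℝ) : ℝ :=
  sInf {r : ℝ | ∃ Q, IsOrth Q ∧ r = frob (X - Y * Q)}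

/-- R is a polar factor P(X) of X: an orthogonal global minimizer of ‖X − Q‖_F over O(d). -/
def IsPolar {d : ℕ} (X R : Matrix (Fin d) (Fin d) ℝ) : Prop :=
  IsOrth R ∧ ∀ Q : Matrix (Fin d) (Fin d) ℝ, IsOrth Q → frob (X - R) ≤ frob (X - Q)

/-- S = P_n(X): blockwise polar factor. -/
def IsPolarBlocks {n d : ℕ} (X S : Matrix (Fin n × Fin d) (Fin d) ℝ) : Prop :=
  ∀ i, IsPolar (blk X i) (blk S i)

/-- U collects (an orthonormal basis of the span of) the top d left singular vectors of D:
U has orthonormal columns and maximizes the Ky Fan quantity trace(Uᵀ(DDᵀ)U). -/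
def IsTopSingVecs {N : Type*} [Fintype N] {d m : ℕ} (D : Matrix N (Fin m) ℝ)
    (U : Matrix N (Fin d) ℝ) : Prop :=
  Uᵀ * U = 1 ∧ ∀ Q : Matrix N (Fin d) ℝ, Qᵀ * Q = 1 →
    Matrix.trace (Qᵀ * (D * Dᵀ) * Q) ≤ Matrix.trace (Uᵀ * (D * Dᵀ) * U)

/-- (U, S, V) is a top-d singular triple of D: orthonormal U, V, diagonal nonnegative S,
DV = US, DᵀU = VS, and U spans a top-d left singular subspace. -/
def IsSVDTriple {N : Type*} [Fintype N] {d m : ℕ} (D : Matrix N (Fin m) ℝ)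
    (U : Matrix N (Fin d) ℝ) (S : Matrix (Fin d) (Fin d) ℝ)
    (V : Matrix (Fin m) (Fin d) ℝ) : Prop :=
  Vᵀ * V = 1 ∧ (∀ a b, a ≠ b → S a b = 0) ∧ (∀ a, 0 ≤ S a a) ∧
    D * V = U * S ∧ Dᵀ * U = V * S ∧ IsTopSingVecs D U

/-- The generalized power method sequence with spectral initialization, run on the data
matrix D (so with C = DDᵀ): S⁰ = P_n(U) for top singular vectors U of D, and
S^{t+1} = P_n(C Sᵗ). -/
def IsGPM {n d m : ℕ} (D : Matrix (Fin n × Fin d) (Fin m) ℝ)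
    (S : ℕ → Matrix (Fin n × Fin d) (Fin d) ℝ) : Prop :=
  (∃ U, IsTopSingVecs D U ∧ IsPolarBlocks U (S 0)) ∧
    ∀ t, IsPolarBlocks (D * Dᵀ * S t) (S (t + 1))

/-- W^(i): W with its i-th block row replaced by 0. -/
def mask {n d m : ℕ} (W : Matrix (Fin n × Fin d) (Fin m) ℝ) (i : Fin n) :
    Matrix (Fin n × Fin d) (Fin m) ℝ :=
  Matrix.of fun p b => if p.1 = i then 0 else W p b

/-- The noise matrix Δ = WAᵀZᵀ + ZAWᵀ + σWWᵀ. -/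
noncomputable def delta {n d m : ℕ} (A : Matrix (Fin d) (Fin m) ℝ)
    (W : Matrix (Fin n × Fin d) (Fin m) ℝ) (σ : ℝ) :
    Matrix (Fin n × Fin d) (Fin n × Fin d) ℝ :=
  W * Aᵀ * (ZStack n d)ᵀ + ZStack n d * A * Wᵀ + σ • (W * Wᵀ)

/-- The i-th block column Δ_i = WAᵀ + ZAW_iᵀ + σWW_iᵀ of Δ. -/
noncomputable def deltaCol {n d m : ℕ} (A : Matrix (Fin d) (Fin m) ℝ)
    (W : Matrix (Fin n × Fin d) (Fin m) ℝ) (σ : ℝ) (i : Fin n) :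
    Matrix (Fin n × Fin d) (Fin d) ℝ :=
  W * Aᵀ + ZStack n d * A * (blk W i)ᵀ + σ • (W * (blk W i)ᵀ)

/-- The operator L S = C S/(n‖A‖²) with C = ZAAᵀZᵀ + σΔ. -/
noncomputable def Lop {n d m : ℕ} (A : Matrix (Fin d) (Fin m) ℝ)
    (W : Matrix (Fin n × Fin d) (Fin m) ℝ) (σ : ℝ)
    (S : Matrix (Fin n × Fin d) (Fin d) ℝ) : Matrix (Fin n × Fin d) (Fin d) ℝ :=
  ((n : ℝ) * opNorm A ^ 2)⁻¹ •
    ((ZStack n d * A * Aᵀ * (ZStack n d)ᵀ + σ • delta A W σ) * S)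

/-- √(nd) + √m + √(2γ n log n). -/
noncomputable def bnd1 (n d m : ℕ) (γ : ℝ) : ℝ :=
  Real.sqrt ((n : ℝ) * d) + Real.sqrt (m : ℝ) + Real.sqrt (2 * γ * n * Real.log n)

/-- √(nd) + √m + √(2γ log n). -/
noncomputable def bnd2 (n d m : ℕ) (γ : ℝ) : ℝ :=
  Real.sqrt ((n : ℝ) * d) + Real.sqrt (m : ℝ) + Real.sqrt (2 * γ * Real.log n)

/-- The basin of attraction N_ε. -/
def memNeps {n d : ℕ} (ε : ℝ) (S : Matrix (Fin n × Fin d) (Fin d) ℝ) : Prop :=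
  OrthBlocks S ∧ dF S (ZStack n d) ≤ ε * Real.sqrt ((n : ℝ) * d)

/-- The basin of attraction N_{ξ,∞}. -/
def memNxi {n d m : ℕ} (W : Matrix (Fin n × Fin d) (Fin m) ℝ) (γ ξ : ℝ)
    (S : Matrix (Fin n × Fin d) (Fin d) ℝ) : Prop :=
  OrthBlocks S ∧ ∀ i, frob (blk W i * Wᵀ * S) ≤ ξ * Real.sqrt (d : ℝ) * bnd1 n d m γ ^ 2

/-- The distribution of a matrix with i.i.d. standard Gaussian N(0,1) entries. -/
noncomputable def stdGaussian (ι κ : Type*) [Fintype ι] [Fintype κ] :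
    Measure (ι → κ → ℝ) :=
  Measure.pi fun _ : ι => Measure.pi fun _ : κ => ProbabilityTheory.gaussianReal 0 1

section Norms

lemma le_of_sq_le {a b : ℝ} (hb : 0 ≤ b) (h : a ^ 2 ≤ b ^ 2) : a ≤ b :=
  abs_le_of_sq_le_sq' h hb |>.2

variable {α β δ : Type*} [Fintype α] [Fintype β] [Fintype δ]

lemma vnorm_eq (v : β → ℝ) : vnorm v = ‖WithLp.toLp 2 v‖ := by
  simp [vnorm, EuclideanSpace.norm_eq]

lemma vnorm_nonneg (v : β → ℝ) : 0 ≤ vnorm v := Real.sqrt_nonneg _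

lemma vnorm_sq (v : β → ℝ) : vnorm v ^ 2 = ∑ j, v j ^ 2 :=
  Real.sq_sqrt (Finset.sum_nonneg fun _ _ => sq_nonneg _)

lemma vnorm_sq_dot (v : β → ℝ) : vnorm v ^ 2 = v ⬝ᵥ v := by
  rw [vnorm_sq]; simp [dotProduct, sq]

lemma vnorm_add_le (v w : β → ℝ) : vnorm (v + w) ≤ vnorm v + vnorm w := by
  simp only [vnorm_eq, WithLp.toLp_add]; exact norm_add_le _ _

lemma vnorm_smul (c : ℝ) (v : β → ℝ) : vnorm (c • v) = |c| * vnorm v := by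
  simp only [vnorm_eq, WithLp.toLp_smul, norm_smul, Real.norm_eq_abs]

lemma vnorm_neg (v : β → ℝ) : vnorm (-v) = vnorm v := by
  simp [vnorm]

lemma vnorm_zero : vnorm (0 : β → ℝ) = 0 := by
  simp [vnorm]

lemma vnorm_eq_zero {v : β → ℝ} (h : vnorm v = 0) : v = 0 := by
  rw [vnorm_eq, norm_eq_zero] at h
  simpa using h

lemma vnorm_sub_le (v w : β → ℝ) : vnorm (v - w) ≤ vnorm v + vnorm w := by
  rw [sub_eq_add_neg, ← vnorm_neg w]; exact vnorm_add_le _ _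

lemma dot_le_vnorm (v w : β → ℝ) : v ⬝ᵥ w ≤ vnorm v * vnorm w :=
  Real.sum_mul_le_sqrt_mul_sqrt Finset.univ v w

lemma frob_eq_vnorm (X : Matrix α β ℝ) : frob X = vnorm fun p : α × β => X p.1 p.2 := by
  simp [frob, vnorm, Fintype.sum_prod_type]

lemma frob_nonneg (X : Matrix α β ℝ) : 0 ≤ frob X := Real.sqrt_nonneg _

lemma frob_sq (X : Matrix α β ℝ) : frob X ^ 2 = ∑ i, ∑ j, X i j ^ 2 :=
  Real.sq_sqrt (Finset.sum_nonneg fun _ _ => Finset.sum_nonneg fun _ _ => sq_nonneg _)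

lemma frob_add_le (X Y : Matrix α β ℝ) : frob (X + Y) ≤ frob X + frob Y := by
  simp only [frob_eq_vnorm]; exact vnorm_add_le _ _

lemma frob_neg (X : Matrix α β ℝ) : frob (-X) = frob X := by
  simp [frob]

lemma frob_sub_comm (X Y : Matrix α β ℝ) : frob (X - Y) = frob (Y - X) := by
  rw [← frob_neg, neg_sub]

lemma frob_sub_le (X Y : Matrix α β ℝ) : frob (X - Y) ≤ frob X + frob Y := by
  rw [sub_eq_add_neg, ← frob_neg Y]; exact frob_add_le _ _

lemma frob_smul (c : ℝ) (X : Matrix α β ℝ) : frob (c • X) = |c| * frob X := by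
  simp only [frob_eq_vnorm]; exact vnorm_smul _ _

lemma frob_zero : frob (0 : Matrix α β ℝ) = 0 := by
  simp [frob]

lemma frob_transpose (X : Matrix α β ℝ) : frob Xᵀ = frob X := by
  unfold frob; rw [Finset.sum_comm]; rfl

lemma frob_sq_eq_trace (X : Matrix α β ℝ) : frob X ^ 2 = trace (Xᵀ * X) := by
  rw [frob_sq, Finset.sum_comm]
  simp [trace, mul_apply, sq]

lemma trace_le_frob (X Y : Matrix α β ℝ) : trace (Xᵀ * Y) ≤ frob X * frob Y := by
  have := dot_le_vnorm (fun p : α × β => X p.1 p.2) (fun p : α × β => Y p.1 p.2)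
  rw [← frob_eq_vnorm, ← frob_eq_vnorm] at this
  refine le_trans (le_of_eq ?_) this
  simp only [trace, diag, mul_apply, transpose_apply, dotProduct, Fintype.sum_prod_type]
  rw [Finset.sum_comm]

lemma trace_transpose_mul_comm (X Y : Matrix α β ℝ) : trace (Xᵀ * Y) = trace (Yᵀ * X) := by
  rw [← trace_transpose, transpose_mul, transpose_transpose]

lemma frob_sub_sq (X Y : Matrix α β ℝ) :
    frob (X - Y) ^ 2 = frob X ^ 2 - 2 * trace (Xᵀ * Y) + frob Y ^ 2 := by
  simp only [frob_sq_eq_trace, transpose_sub, Matrix.sub_mul, Matrix.mul_sub, trace_sub]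
  rw [trace_transpose_mul_comm Y X]; ring

/-- `K` bounds the operator norm of `X`. -/
def OpLe (X : Matrix α β ℝ) (K : ℝ) : Prop :=
  0 ≤ K ∧ ∀ v, vnorm (X *ᵥ v) ≤ K * vnorm v

lemma frob_sq_eq_sum_col (X : Matrix α β ℝ) : frob X ^ 2 = ∑ j, vnorm (fun i => X i j) ^ 2 := by
  rw [frob_sq, Finset.sum_comm]; simp [vnorm_sq]

lemma frob_mul_le {X : Matrix α β ℝ} {K : ℝ} (hX : OpLe X K) (Y : Matrix β δ ℝ) :
    frob (X * Y) ≤ K * frob Y := by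
  refine le_of_sq_le (mul_nonneg hX.1 (frob_nonneg _)) ?_
  rw [mul_pow, frob_sq_eq_sum_col, frob_sq_eq_sum_col, Finset.mul_sum]
  refine Finset.sum_le_sum fun j _ => ?_
  rw [← mul_pow]
  exact pow_le_pow_left₀ (vnorm_nonneg _) (hX.2 fun i => Y i j) 2

lemma dot_mulVec_transpose (X : Matrix α β ℝ) (u : α → ℝ) (v : β → ℝ) :
    u ⬝ᵥ (X *ᵥ v) = (Xᵀ *ᵥ u) ⬝ᵥ v := by
  rw [dotProduct_mulVec, mulVec_transpose]

lemma vnorm_mulVec_sq (X : Matrix α β ℝ) (v : β → ℝ) :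
    vnorm (X *ᵥ v) ^ 2 = v ⬝ᵥ ((Xᵀ * X) *ᵥ v) := by
  rw [vnorm_sq_dot, ← mulVec_mulVec, dot_mulVec_transpose Xᵀ, transpose_transpose]

lemma OpLe.transpose {X : Matrix α β ℝ} {K : ℝ} (hX : OpLe X K) : OpLe Xᵀ K := by
  refine ⟨hX.1, fun u => ?_⟩
  have h1 : vnorm (Xᵀ *ᵥ u) ^ 2 ≤ vnorm u * (K * vnorm (Xᵀ *ᵥ u)) := by
    rw [vnorm_sq_dot, ← dot_mulVec_transpose]
    exact (dot_le_vnorm _ _).trans (mul_le_mul_of_nonneg_left (hX.2 _) (vnorm_nonneg _))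
  rcases (vnorm_nonneg (Xᵀ *ᵥ u)).eq_or_lt with h | h
  · rw [← h]; exact mul_nonneg hX.1 (vnorm_nonneg _)
  · nlinarith

lemma frob_mul_le_right {Y : Matrix β δ ℝ} {K : ℝ} (hY : OpLe Y K) (X : Matrix α β ℝ) :
    frob (X * Y) ≤ K * frob X := by
  rw [← frob_transpose, transpose_mul, ← frob_transpose X]
  exact frob_mul_le hY.transpose _

lemma vnorm_mulVec_le_frob (X : Matrix α β ℝ) (v : β → ℝ) :
    vnorm (X *ᵥ v) ≤ frob X * vnorm v := by
  refine le_of_sq_le (mul_nonneg (frob_nonneg _) (vnorm_nonneg _)) ?_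
  rw [mul_pow, frob_sq, vnorm_sq, vnorm_sq, Finset.sum_mul]
  exact Finset.sum_le_sum fun i _ => Finset.sum_mul_sq_le_sq_mul_sq _ _ _

lemma opLe_frob (X : Matrix α β ℝ) : OpLe X (frob X) :=
  ⟨frob_nonneg _, vnorm_mulVec_le_frob X⟩

lemma OpLe.mul {X : Matrix α β ℝ} {Y : Matrix β δ ℝ} {K L : ℝ} (hX : OpLe X K) (hY : OpLe Y L) :
    OpLe (X * Y) (K * L) := by
  refine ⟨mul_nonneg hX.1 hY.1, fun v => ?_⟩
  rw [← mulVec_mulVec, mul_assoc]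
  exact (hX.2 _).trans (mul_le_mul_of_nonneg_left (hY.2 _) hX.1)

lemma OpLe.mono {X : Matrix α β ℝ} {K L : ℝ} (hX : OpLe X K) (h : K ≤ L) : OpLe X L :=
  ⟨hX.1.trans h, fun v => (hX.2 v).trans (mul_le_mul_of_nonneg_right h (vnorm_nonneg _))⟩

lemma opLe_one [DecidableEq β] : OpLe (1 : Matrix β β ℝ) 1 :=
  ⟨zero_le_one, fun v => by rw [one_mulVec, one_mul]⟩

lemma frob_one_sq [DecidableEq β] : frob (1 : Matrix β β ℝ) ^ 2 = Fintype.card β := by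
  rw [frob_sq_eq_trace]; simp

lemma frob_one [DecidableEq β] : frob (1 : Matrix β β ℝ) = √(Fintype.card β : ℝ) := by
  rw [← frob_one_sq, Real.sqrt_sq (frob_nonneg _)]

lemma frob_le_of_opLe {X : Matrix α β ℝ} {K : ℝ} (hX : OpLe X K) :
    frob X ≤ K * √(Fintype.card β : ℝ) := by
  classical
  have := frob_mul_le hX (1 : Matrix β β ℝ)
  rwa [Matrix.mul_one, frob_one] at this

/-- A matrix with orthonormal columns preserves the Frobenius norm. -/
lemma frob_mul_of_transpose_mul [DecidableEq β] {Q : Matrix α β ℝ} (hQ : Qᵀ * Q = 1)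
    (X : Matrix β δ ℝ) : frob (Q * X) = frob X := by
  have : frob (Q * X) ^ 2 = frob X ^ 2 := by
    rw [frob_sq_eq_trace, frob_sq_eq_trace, transpose_mul, Matrix.mul_assoc,
      ← Matrix.mul_assoc Qᵀ, hQ, Matrix.one_mul]
  exact (pow_left_inj₀ (frob_nonneg _) (frob_nonneg _) two_ne_zero).1 this

lemma vnorm_mulVec_of_transpose_mul [DecidableEq β] {Q : Matrix α β ℝ} (hQ : Qᵀ * Q = 1)
    (v : β → ℝ) : vnorm (Q *ᵥ v) = vnorm v := by
  have : vnorm (Q *ᵥ v) ^ 2 = vnorm v ^ 2 := by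
    rw [vnorm_mulVec_sq, hQ, one_mulVec, vnorm_sq_dot]
  exact (pow_left_inj₀ (vnorm_nonneg _) (vnorm_nonneg _) two_ne_zero).1 this

lemma opLe_of_transpose_mul [DecidableEq β] {Q : Matrix α β ℝ} (hQ : Qᵀ * Q = 1) : OpLe Q 1 :=
  ⟨zero_le_one, fun v => by rw [vnorm_mulVec_of_transpose_mul hQ, one_mul]⟩

lemma abs_entry_le_frob (X : Matrix α β ℝ) (i : α) (j : β) : |X i j| ≤ frob X := by
  rw [← Real.sqrt_sq_eq_abs]
  refine Real.sqrt_le_sqrt ?_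
  refine (Finset.single_le_sum (f := fun j => X i j ^ 2) (fun _ _ => sq_nonneg _)
    (Finset.mem_univ j)).trans ?_
  exact Finset.single_le_sum (f := fun i => ∑ j, X i j ^ 2)
    (fun _ _ => Finset.sum_nonneg fun _ _ => sq_nonneg _) (Finset.mem_univ i)

lemma vnorm_continuous : Continuous (vnorm : (β → ℝ) → ℝ) := by
  unfold vnorm; fun_prop

lemma frob_continuous : Continuous (frob : Matrix α β ℝ → ℝ) := by
  unfold frob; fun_prop

/-- Normalisation of a nonzero vector. -/
lemma vnorm_normalize {v : β → ℝ} (hv : vnorm v ≠ 0) : vnorm ((vnorm v)⁻¹ • v) = 1 := by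
  rw [vnorm_smul, abs_of_nonneg (inv_nonneg.2 (vnorm_nonneg _)), inv_mul_cancel₀ hv]

lemma opLe_opNorm (X : Matrix α β ℝ) : OpLe X (opNorm X) := by
  have hb : BddAbove {r : ℝ | ∃ u : β → ℝ, vnorm u = 1 ∧ r = vnorm (X *ᵥ u)} := by
    refine ⟨frob X, ?_⟩
    rintro r ⟨u, hu, rfl⟩
    simpa [hu] using vnorm_mulVec_le_frob X u
  refine ⟨Real.sSup_nonneg ?_, fun v => ?_⟩
  · rintro r ⟨u, -, rfl⟩; exact vnorm_nonneg _
  · by_cases hv : vnorm v = 0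
    · rw [vnorm_eq_zero hv, mulVec_zero, vnorm_zero, vnorm_zero, mul_zero]
    · have h1 : vnorm (X *ᵥ ((vnorm v)⁻¹ • v)) ≤ opNorm X :=
        le_csSup hb ⟨_, vnorm_normalize hv, rfl⟩
      rw [mulVec_smul, vnorm_smul, abs_of_nonneg (inv_nonneg.2 (vnorm_nonneg _))] at h1
      rwa [inv_mul_le_iff₀ (lt_of_le_of_ne (vnorm_nonneg _) (Ne.symm hv)), mul_comm] at h1

lemma sigmaMin_le (X : Matrix α β ℝ) (u : α → ℝ) :
    sigmaMin X * vnorm u ≤ vnorm (Xᵀ *ᵥ u) := by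
  rw [mulVec_transpose]
  by_cases hu : vnorm u = 0
  · rw [hu, mul_zero]; exact vnorm_nonneg _
  · have h1 : sigmaMin X ≤ vnorm (((vnorm u)⁻¹ • u) ᵥ* X) :=
      csInf_le ⟨0, by rintro r ⟨u, -, rfl⟩; exact vnorm_nonneg _⟩ ⟨_, vnorm_normalize hu, rfl⟩
    rw [smul_vecMul, vnorm_smul, abs_of_nonneg (inv_nonneg.2 (vnorm_nonneg _))] at h1
    have hp : 0 < vnorm u := lt_of_le_of_ne (vnorm_nonneg _) (Ne.symm hu)
    rwa [inv_mul_eq_div, le_div_iff₀ hp] at h1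

lemma exists_vnorm_eq_one [Nonempty β] : ∃ v : β → ℝ, vnorm v = 1 := by
  classical
  refine ⟨Pi.single (Classical.arbitrary β) 1, ?_⟩
  simp [vnorm, Pi.single_apply]

lemma sigmaMin_le_opNorm [Nonempty α] (X : Matrix α β ℝ) : sigmaMin X ≤ opNorm X := by
  obtain ⟨u, hu⟩ := exists_vnorm_eq_one (β := α)
  have h1 := sigmaMin_le X u
  have h2 := (opLe_opNorm X).transpose.2 u
  rw [hu, mul_one] at h1 h2
  exact h1.trans h2

end Norms

section Polar

variable {d : ℕ}

lemma IsOrth.one : IsOrth (1 : Matrix (Fin d) (Fin d) ℝ) := by simp [IsOrth]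

lemma IsOrth.transpose {Q : Matrix (Fin d) (Fin d) ℝ} (h : IsOrth Q) : IsOrth Qᵀ := by
  simpa [IsOrth] using h.symm

lemma isOrth_of_transpose_mul {Q : Matrix (Fin d) (Fin d) ℝ} (h : Qᵀ * Q = 1) : IsOrth Q :=
  ⟨h, mul_eq_one_comm.1 h⟩

lemma IsOrth.mul {Q R : Matrix (Fin d) (Fin d) ℝ} (hQ : IsOrth Q) (hR : IsOrth R) :
    IsOrth (Q * R) := by
  refine isOrth_of_transpose_mul ?_
  rw [transpose_mul, Matrix.mul_assoc, ← Matrix.mul_assoc Qᵀ, hQ.1, Matrix.one_mul, hR.1]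

lemma frob_mul_orth {α : Type*} [Fintype α] {Q : Matrix (Fin d) (Fin d) ℝ} (hQ : IsOrth Q)
    (X : Matrix α (Fin d) ℝ) :
    frob (X * Q) = frob X := by
  rw [← frob_transpose, transpose_mul, frob_mul_of_transpose_mul (by simpa using hQ.2),
    frob_transpose]

lemma frob_orth_sq {Q : Matrix (Fin d) (Fin d) ℝ} (hQ : IsOrth Q) : frob Q ^ 2 = d := by
  rw [frob_sq_eq_trace, hQ.1]; simp

lemma isPolar_iff {X R : Matrix (Fin d) (Fin d) ℝ} :
    IsPolar X R ↔ IsOrth R ∧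
      ∀ Q : Matrix (Fin d) (Fin d) ℝ, IsOrth Q → trace (Qᵀ * X) ≤ trace (Rᵀ * X) := by
  refine and_congr_right fun hR => forall₂_congr fun Q hQ => ?_
  rw [← sq_le_sq₀ (frob_nonneg _) (frob_nonneg _), frob_sub_sq, frob_sub_sq, frob_orth_sq hR,
    frob_orth_sq hQ, trace_transpose_mul_comm X, trace_transpose_mul_comm X]
  constructor <;> intro h <;> linarith

lemma isCompact_isOrth : IsCompact {Q : Matrix (Fin d) (Fin d) ℝ | IsOrth Q} := by
  have hbox : IsCompact (Set.univ.pi fun _ : Fin d => Set.univ.pi fun _ : Fin d =>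
      Set.Icc (-√(d : ℝ)) (√(d : ℝ))) :=
    isCompact_univ_pi fun _ => isCompact_univ_pi fun _ => isCompact_Icc
  refine IsCompact.of_isClosed_subset hbox ?_ ?_
  · have h1 : IsClosed {Q : Matrix (Fin d) (Fin d) ℝ | Qᵀ * Q = 1} :=
      isClosed_eq (by fun_prop) continuous_const
    have h2 : IsClosed {Q : Matrix (Fin d) (Fin d) ℝ | Q * Qᵀ = 1} :=
      isClosed_eq (by fun_prop) continuous_const
    exact h1.inter h2
  · intro Q hQ i _ j _
    rw [Set.mem_Icc, ← abs_le]
    refine (abs_entry_le_frob Q i j).trans (le_of_eq ?_)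
    rw [← frob_orth_sq hQ, Real.sqrt_sq (frob_nonneg _)]

lemma exists_isPolar (X : Matrix (Fin d) (Fin d) ℝ) : ∃ R, IsPolar X R := by
  obtain ⟨R, hR, hmin⟩ := isCompact_isOrth.exists_isMinOn
    ⟨(1 : Matrix (Fin d) (Fin d) ℝ), IsOrth.one⟩
    (f := fun Q : Matrix (Fin d) (Fin d) ℝ => frob (X - Q))
    (frob_continuous.comp (continuous_const.sub continuous_id)).continuousOn
  exact ⟨R, hR, fun Q hQ => hmin hQ⟩

lemma IsPolar.mul_right {X R Q : Matrix (Fin d) (Fin d) ℝ} (h : IsPolar X R) (hQ : IsOrth Q) :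
    IsPolar (X * Q) (R * Q) := by
  refine ⟨h.1.mul hQ, fun P hP => ?_⟩
  have h1 : P = P * Qᵀ * Q := by rw [Matrix.mul_assoc, hQ.1, Matrix.mul_one]
  rw [h1, ← Matrix.sub_mul, ← Matrix.sub_mul, frob_mul_orth hQ, frob_mul_orth hQ]
  exact h.2 _ (hP.mul hQ.transpose)

/-- The Householder reflection along `v`. -/
noncomputable def householder (v : Fin d → ℝ) : Matrix (Fin d) (Fin d) ℝ :=
  1 - (2 / (v ⬝ᵥ v)) • vecMulVec v v

lemma householder_transpose (v : Fin d → ℝ) : (householder v)ᵀ = householder v := by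
  simp [householder, transpose_vecMulVec]

lemma isOrth_householder {v : Fin d → ℝ} (hv : v ⬝ᵥ v ≠ 0) : IsOrth (householder v) := by
  refine isOrth_of_transpose_mul ?_
  rw [householder_transpose]
  simp only [householder, Matrix.sub_mul, Matrix.mul_sub, Matrix.one_mul, Matrix.mul_one,
    Matrix.smul_mul, Matrix.mul_smul, vecMulVec_mul_vecMulVec]
  rw [vecMulVec_smul, smul_smul]
  have : 2 / (v ⬝ᵥ v) * (v ⬝ᵥ v) = 1 + 1 := by
    field_simp; norm_num
  rw [this, add_smul, one_smul]; simp

lemma trace_vecMulVec_mul (u v : Fin d → ℝ) (H : Matrix (Fin d) (Fin d) ℝ) :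
    trace (vecMulVec u v * H) = v ⬝ᵥ (H *ᵥ u) := by
  rw [vecMulVec_mul, trace_vecMulVec, dotProduct_comm, ← dotProduct_mulVec]

/-- If the identity maximises `⟨Q, H⟩` over the orthogonal group, then `H` is symmetric
positive semidefinite. -/
lemma nonneg_of_trace_le {H : Matrix (Fin d) (Fin d) ℝ}
    (h : ∀ Q : Matrix (Fin d) (Fin d) ℝ, IsOrth Q → trace (Qᵀ * H) ≤ trace H)
    (v : Fin d → ℝ) : 0 ≤ v ⬝ᵥ (H *ᵥ v) := by
  by_cases hv : v ⬝ᵥ v = 0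
  · have : v = 0 := dotProduct_self_eq_zero.1 hv
    simp [this]
  · have h1 := h _ (isOrth_householder hv)
    rw [householder_transpose, householder, Matrix.sub_mul, Matrix.one_mul, trace_sub,
      Matrix.smul_mul, trace_smul, trace_vecMulVec_mul, smul_eq_mul] at h1
    have h2 : 0 < v ⬝ᵥ v := lt_of_le_of_ne (by rw [← vnorm_sq_dot]; positivity) (Ne.symm hv)
    have h3 : 0 ≤ 2 / (v ⬝ᵥ v) * (v ⬝ᵥ (H *ᵥ v)) := by linarith
    exact (mul_nonneg_iff_of_pos_left (by positivity)).1 h3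

lemma two_mul_dot_le_of_trace_le {H : Matrix (Fin d) (Fin d) ℝ}
    (h : ∀ Q : Matrix (Fin d) (Fin d) ℝ, IsOrth Q → trace (Qᵀ * H) ≤ trace H) {u v : Fin d → ℝ}
    (hu : u ⬝ᵥ u ≠ 0) (hv : v ⬝ᵥ v ≠ 0) :
    2 * (u ⬝ᵥ v) * (u ⬝ᵥ (H *ᵥ v)) ≤
      (v ⬝ᵥ v) * (u ⬝ᵥ (H *ᵥ u)) + (u ⬝ᵥ u) * (v ⬝ᵥ (H *ᵥ v)) := by
  have h1 := h _ ((isOrth_householder hu).mul (isOrth_householder hv))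
  rw [transpose_mul, householder_transpose, householder_transpose] at h1
  simp only [householder, Matrix.sub_mul, Matrix.mul_sub, Matrix.one_mul, Matrix.mul_one,
    Matrix.smul_mul, Matrix.mul_smul, vecMulVec_mul_vecMulVec, smul_smul, trace_sub, trace_smul,
    smul_eq_mul, trace_vecMulVec_mul, vecMulVec_smul] at h1
  have h2 : 0 < v ⬝ᵥ v := lt_of_le_of_ne (by rw [← vnorm_sq_dot]; positivity) (Ne.symm hv)
  have h3 : 0 < u ⬝ᵥ u := lt_of_le_of_ne (by rw [← vnorm_sq_dot]; positivity) (Ne.symm hu)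
  rw [dotProduct_comm v u] at h1
  have h4 : 2 / (u ⬝ᵥ u) * (2 / (v ⬝ᵥ v)) * (u ⬝ᵥ v) * (u ⬝ᵥ (H *ᵥ v)) ≤
      2 / (u ⬝ᵥ u) * (u ⬝ᵥ (H *ᵥ u)) + 2 / (v ⬝ᵥ v) * (v ⬝ᵥ (H *ᵥ v)) := by linarith
  have h5 : 0 ≤ ((u ⬝ᵥ u) * (v ⬝ᵥ v) / 2) := by positivity
  have h6 := mul_le_mul_of_nonneg_left h4 h5
  have e1 : (u ⬝ᵥ u) * (v ⬝ᵥ v) / 2 *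
      (2 / (u ⬝ᵥ u) * (2 / (v ⬝ᵥ v)) * (u ⬝ᵥ v) * (u ⬝ᵥ (H *ᵥ v))) =
      2 * (u ⬝ᵥ v) * (u ⬝ᵥ (H *ᵥ v)) := by field_simp
  have e2 : (u ⬝ᵥ u) * (v ⬝ᵥ v) / 2 *
      (2 / (u ⬝ᵥ u) * (u ⬝ᵥ (H *ᵥ u)) + 2 / (v ⬝ᵥ v) * (v ⬝ᵥ (H *ᵥ v))) =
      (v ⬝ᵥ v) * (u ⬝ᵥ (H *ᵥ u)) + (u ⬝ᵥ u) * (v ⬝ᵥ (H *ᵥ v)) := by field_simp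
  rwa [e1, e2] at h6

lemma le_zero_of_forall_mul_le_sq {a b : ℝ} (h : ∀ s : ℝ, s * a ≤ s ^ 2 * b) : a = 0 := by
  by_contra ha
  have hb : 0 < |b| + 1 := by positivity
  have h1 := h (a / (2 * (|b| + 1)))
  have h2 : 0 < a ^ 2 := by positivity
  have h3 : a / (2 * (|b| + 1)) * a = a ^ 2 / (2 * (|b| + 1)) := by ring
  have h4 : (a / (2 * (|b| + 1))) ^ 2 * b = a ^ 2 / (2 * (|b| + 1)) * (b / (2 * (|b| + 1))) := by
    ring
  rw [h3, h4] at h1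
  have h5 : b / (2 * (|b| + 1)) < 1 := by
    rw [div_lt_one (by positivity)]; linarith [le_abs_self b, abs_nonneg b]
  have h6 : 0 < a ^ 2 / (2 * (|b| + 1)) := by positivity
  nlinarith

lemma symm_of_trace_le {H : Matrix (Fin d) (Fin d) ℝ}
    (h : ∀ Q : Matrix (Fin d) (Fin d) ℝ, IsOrth Q → trace (Qᵀ * H) ≤ trace H) :
    Hᵀ = H := by
  ext b a
  rw [transpose_apply]
  by_cases hab : a = b
  · rw [hab]
  have key : H a b - H b a = 0 := by
    refine le_zero_of_forall_mul_le_sq (b := H a a + H b b) fun s => ?_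
    set u : Fin d → ℝ := Pi.single a 1 with hu
    set w : Fin d → ℝ := Pi.single b 1 with hw
    have huu : u ⬝ᵥ u = 1 := by simp [hu]
    have hww : w ⬝ᵥ w = 1 := by simp [hw]
    have huw : u ⬝ᵥ w = 0 := by simp [hu, hw, Ne.symm hab]
    have hwu : w ⬝ᵥ u = 0 := by rw [dotProduct_comm, huw]
    have e : ∀ i j : Fin d, (Pi.single i 1 : Fin d → ℝ) ⬝ᵥ (H *ᵥ Pi.single j 1) = H i j := by
      intro i j; simp
    have h1 := two_mul_dot_le_of_trace_le h (u := u) (v := u + s • w) (by rw [huu]; norm_num)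
      (by
        simp only [add_dotProduct, dotProduct_add, smul_dotProduct, dotProduct_smul, huu, hww,
          huw, hwu, smul_eq_mul]
        nlinarith [sq_nonneg s])
    simp only [add_dotProduct, dotProduct_add, smul_dotProduct, dotProduct_smul, huu, hww,
      huw, hwu, smul_eq_mul, mulVec_add, mulVec_smul] at h1
    simp only [hu, hw, e] at h1
    nlinarith [h1]
  linarith

lemma IsPolar.trace_le {X R : Matrix (Fin d) (Fin d) ℝ} (h : IsPolar X R)
    (Q : Matrix (Fin d) (Fin d) ℝ) (hQ : IsOrth Q) :
    trace (Qᵀ * (Rᵀ * X)) ≤ trace (Rᵀ * X) := by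
  have := (isPolar_iff.1 h).2 _ (h.1.mul hQ)
  rwa [transpose_mul, Matrix.mul_assoc] at this

lemma IsPolar.symm {X R : Matrix (Fin d) (Fin d) ℝ} (h : IsPolar X R) : (Rᵀ * X)ᵀ = Rᵀ * X :=
  symm_of_trace_le h.trace_le

lemma IsPolar.nonneg {X R : Matrix (Fin d) (Fin d) ℝ} (h : IsPolar X R) (v : Fin d → ℝ) :
    0 ≤ v ⬝ᵥ ((Rᵀ * X) *ᵥ v) :=
  nonneg_of_trace_le h.trace_le v

lemma IsPolar.lower_bound {X R : Matrix (Fin d) (Fin d) ℝ} (h : IsPolar X R) {s : ℝ}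
    (hX : ∀ v, s * vnorm v ≤ vnorm (X *ᵥ v)) (v : Fin d → ℝ) :
    s * vnorm v ^ 2 ≤ v ⬝ᵥ ((Rᵀ * X) *ᵥ v) := by
  set H := Rᵀ * X with hH
  have hsym : Hᵀ = H := h.symm
  have hlow : ∀ v, s * vnorm v ≤ vnorm (H *ᵥ v) := fun v => by
    rw [hH, ← mulVec_mulVec, vnorm_mulVec_of_transpose_mul h.1.transpose.1]; exact hX v
  have hherm : (H - s • (1 : Matrix (Fin d) (Fin d) ℝ)).IsHermitian := by
    rw [IsHermitian, conjTranspose_eq_transpose_of_trivial, transpose_sub, transpose_smul,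
      transpose_one, hsym]
  have hpsd : (H - s • (1 : Matrix (Fin d) (Fin d) ℝ)).PosSemidef := by
    rw [hherm.posSemidef_iff_eigenvalues_nonneg]
    intro j
    set μ := hherm.eigenvalues j
    set w : Fin d → ℝ := ⇑(hherm.eigenvectorBasis j)
    have hw : (H - s • (1 : Matrix (Fin d) (Fin d) ℝ)) *ᵥ w = μ • w :=
      hherm.mulVec_eigenvectorBasis j
    have hw1 : vnorm w = 1 := by
      rw [vnorm_eq]; exact hherm.eigenvectorBasis.orthonormal.1 j
    have hHw : H *ᵥ w = (μ + s) • w := by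
      rw [sub_mulVec, smul_mulVec, one_mulVec, sub_eq_iff_eq_add] at hw
      rw [hw, add_smul]
    have h1 := hlow w
    have h2 := h.nonneg w
    rw [← hH, hHw, dotProduct_smul, ← vnorm_sq_dot, hw1] at h2
    rw [hHw, vnorm_smul, hw1] at h1
    have h3 : 0 ≤ μ + s := by simpa using h2
    rw [abs_of_nonneg h3] at h1
    change 0 ≤ μ
    linarith
  have h4 := hpsd.dotProduct_mulVec_nonneg v
  rw [sub_mulVec, smul_mulVec, one_mulVec, star_trivial, dotProduct_sub, dotProduct_smul,
    ← vnorm_sq_dot, smul_eq_mul] at h4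
  linarith

lemma trace_conj_ge {α : Type*} [Fintype α] {H : Matrix (Fin d) (Fin d) ℝ}
    {F : Matrix α (Fin d) ℝ} {s : ℝ}
    (hH : ∀ v, s * vnorm v ^ 2 ≤ v ⬝ᵥ (H *ᵥ v)) :
    s * frob F ^ 2 ≤ trace (F * H * Fᵀ) := by
  have h1 : trace (F * H * Fᵀ) = ∑ i, (fun j => F i j) ⬝ᵥ (H *ᵥ fun j => F i j) := by
    refine Finset.sum_congr rfl fun i _ => ?_
    rw [diag_apply, Matrix.mul_assoc, mul_apply']
    rfl
  rw [h1, frob_sq, Finset.mul_sum]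
  refine Finset.sum_le_sum fun i _ => ?_
  rw [← vnorm_sq]
  exact hH _

/-- Quadratic growth of `⟨·, X⟩` around the polar factor of `X`. -/
lemma IsPolar.gap {X R Q : Matrix (Fin d) (Fin d) ℝ} (h : IsPolar X R) (hQ : IsOrth Q) {s : ℝ}
    (hX : ∀ v, s * vnorm v ≤ vnorm (X *ᵥ v)) :
    s / 2 * frob (R - Q) ^ 2 ≤ trace (Rᵀ * X) - trace (Qᵀ * X) := by
  set H := Rᵀ * X with hH
  set E := Rᵀ * Q with hE
  have hEo : IsOrth E := h.1.transpose.mul hQ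
  have hsym : Hᵀ = H := h.symm
  have h1 : frob (R - Q) = frob (1 - E) := by
    rw [← frob_mul_of_transpose_mul (Q := Rᵀ) (by simpa using h.1.2), Matrix.mul_sub, h.1.1]
  have h2 : trace (Qᵀ * X) = trace (Eᵀ * H) := by
    rw [hE, hH, transpose_mul, transpose_transpose, Matrix.mul_assoc, ← Matrix.mul_assoc R,
      h.1.2, Matrix.one_mul]
  have h3 : trace ((1 - E) * H * (1 - E)ᵀ) = 2 * (trace H - trace (Eᵀ * H)) := by
    have e1 : trace (E * H) = trace (Eᵀ * H) := by
      rw [← trace_transpose, transpose_mul, hsym, trace_mul_comm]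
    have e2 : trace (H * Eᵀ) = trace (Eᵀ * H) := trace_mul_comm _ _
    have e3 : trace (E * H * Eᵀ) = trace H := by
      rw [trace_mul_comm, ← Matrix.mul_assoc, hEo.1, Matrix.one_mul]
    simp only [transpose_sub, transpose_one, Matrix.sub_mul, Matrix.mul_sub, Matrix.one_mul,
      Matrix.mul_one, trace_sub, e1, e2, e3]
    ring
  have h4 := trace_conj_ge (F := 1 - E) (h.lower_bound hX)
  rw [h1, h2]
  rw [← hH, h3] at h4
  linarith

/-- One-sided Lipschitz estimate for polar factors. -/
lemma IsPolar.dist_le {X Y R T : Matrix (Fin d) (Fin d) ℝ} (hR : IsPolar X R) (hT : IsPolar Y T)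
    {s : ℝ} (hs : 0 < s)
    (hY : ∀ v, s * vnorm v ≤ vnorm (Y *ᵥ v)) :
    frob (R - T) ≤ 2 / s * frob (X - Y) := by
  have h1 := hT.gap hR.1 hY
  have h2 := (isPolar_iff.1 hR).2 _ hT.1
  have h3 := trace_le_frob (R - T) (X - Y)
  simp only [transpose_sub, Matrix.sub_mul, Matrix.mul_sub, trace_sub] at h3
  rw [frob_sub_comm T R] at h1
  have h4 : s / 2 * frob (R - T) ^ 2 ≤ frob (R - T) * frob (X - Y) := by linarith
  rcases (frob_nonneg (R - T)).eq_or_lt with h | h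
  · rw [← h]; exact mul_nonneg (by positivity) (frob_nonneg _)
  · have h5 : s / 2 * frob (R - T) ≤ frob (X - Y) := by nlinarith
    rw [div_mul_eq_mul_div, le_div_iff₀ hs]; linarith

end Polar

section Blocks

variable {n d m k l : ℕ}

lemma blk_mul (X : Matrix (Fin n × Fin d) (Fin k) ℝ) (Y : Matrix (Fin k) (Fin l) ℝ) (i : Fin n) :
    blk (X * Y) i = blk X i * Y := rfl

lemma blk_add (X Y : Matrix (Fin n × Fin d) (Fin k) ℝ) (i : Fin n) :
    blk (X + Y) i = blk X i + blk Y i := rfl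

lemma blk_sub (X Y : Matrix (Fin n × Fin d) (Fin k) ℝ) (i : Fin n) :
    blk (X - Y) i = blk X i - blk Y i := rfl

lemma blk_smul (c : ℝ) (X : Matrix (Fin n × Fin d) (Fin k) ℝ) (i : Fin n) :
    blk (c • X) i = c • blk X i := rfl

lemma blk_ZStack (i : Fin n) : blk (ZStack n d) i = 1 := by
  ext a b; simp [blk, ZStack, Matrix.one_apply]

lemma blk_stack (B : Fin n → Matrix (Fin d) (Fin k) ℝ) (i : Fin n) : blk (stack B) i = B i := rfl

lemma frob_sq_blk (S : Matrix (Fin n × Fin d) (Fin k) ℝ) :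
    frob S ^ 2 = ∑ i, frob (blk S i) ^ 2 := by
  simp [frob_sq, Fintype.sum_prod_type, blk]

lemma frob_blk_le (S : Matrix (Fin n × Fin d) (Fin k) ℝ) (i : Fin n) :
    frob (blk S i) ≤ frob S := by
  refine le_of_sq_le (frob_nonneg _) ?_
  rw [frob_sq_blk]
  exact Finset.single_le_sum (f := fun i => frob (blk S i) ^ 2) (fun _ _ => sq_nonneg _)
    (Finset.mem_univ i)

lemma frob_le_of_blk_le {S : Matrix (Fin n × Fin d) (Fin k) ℝ} {r : ℝ} (hr : 0 ≤ r)
    (h : ∀ i, frob (blk S i) ≤ r) : frob S ≤ √(n : ℝ) * r := by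
  refine le_of_sq_le (by positivity) ?_
  rw [frob_sq_blk, mul_pow, Real.sq_sqrt (Nat.cast_nonneg n)]
  calc ∑ i, frob (blk S i) ^ 2 ≤ ∑ _i : Fin n, r ^ 2 :=
        Finset.sum_le_sum fun i _ => pow_le_pow_left₀ (frob_nonneg _) (h i) 2
    _ = n * r ^ 2 := by simp

lemma transpose_mul_eq_sum_blk (X : Matrix (Fin n × Fin d) (Fin k) ℝ)
    (Y : Matrix (Fin n × Fin d) (Fin l) ℝ) : Xᵀ * Y = ∑ i, (blk X i)ᵀ * blk Y i := by
  ext a b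
  simp [mul_apply, Fintype.sum_prod_type, blk, Matrix.sum_apply]

lemma OrthBlocks.transpose_mul_self {S : Matrix (Fin n × Fin d) (Fin d) ℝ} (h : OrthBlocks S) :
    Sᵀ * S = (n : ℝ) • 1 := by
  rw [transpose_mul_eq_sum_blk, Finset.sum_congr rfl fun i _ => (h i).1]
  simp [Nat.cast_smul_eq_nsmul]

lemma OrthBlocks.opLe {S : Matrix (Fin n × Fin d) (Fin d) ℝ} (h : OrthBlocks S) :
    OpLe S √(n : ℝ) := by
  refine ⟨Real.sqrt_nonneg _, fun v => le_of_sq_le (by positivity [vnorm_nonneg v]) ?_⟩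
  rw [vnorm_mulVec_sq, h.transpose_mul_self, smul_mulVec, one_mulVec, dotProduct_smul,
    ← vnorm_sq_dot, mul_pow, Real.sq_sqrt (Nat.cast_nonneg n), smul_eq_mul]

lemma OrthBlocks.frob_eq {S : Matrix (Fin n × Fin d) (Fin d) ℝ} (h : OrthBlocks S) :
    frob S = √(n : ℝ) * √(d : ℝ) := by
  rw [← Real.sqrt_sq (frob_nonneg S), ← Real.sqrt_mul (Nat.cast_nonneg n), frob_sq_eq_trace,
    h.transpose_mul_self]
  simp

lemma orthBlocks_ZStack : OrthBlocks (ZStack n d) := fun i => by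
  rw [blk_ZStack]; exact IsOrth.one

lemma OrthBlocks.mul {S : Matrix (Fin n × Fin d) (Fin d) ℝ} (h : OrthBlocks S)
    {Q : Matrix (Fin d) (Fin d) ℝ} (hQ : IsOrth Q) : OrthBlocks (S * Q) := fun i => by
  rw [blk_mul]; exact (h i).mul hQ

lemma IsPolarBlocks.orthBlocks {X S : Matrix (Fin n × Fin d) (Fin d) ℝ} (h : IsPolarBlocks X S) :
    OrthBlocks S := fun i => (h i).1

lemma IsPolarBlocks.mul_right {X S : Matrix (Fin n × Fin d) (Fin d) ℝ} (h : IsPolarBlocks X S)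
    {Q : Matrix (Fin d) (Fin d) ℝ} (hQ : IsOrth Q) : IsPolarBlocks (X * Q) (S * Q) := fun i => by
  rw [blk_mul, blk_mul]; exact (h i).mul_right hQ

lemma IsPolarBlocks.dist_le {X Y R T : Matrix (Fin n × Fin d) (Fin d) ℝ}
    (hR : IsPolarBlocks X R) (hT : IsPolarBlocks Y T) {s : ℝ} (hs : 0 < s)
    (hY : ∀ i v, s * vnorm v ≤ vnorm (blk Y i *ᵥ v)) :
    frob (R - T) ≤ 2 / s * frob (X - Y) := by
  refine le_of_sq_le (mul_nonneg (by positivity) (frob_nonneg _)) ?_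
  rw [mul_pow, frob_sq_blk, frob_sq_blk, Finset.mul_sum]
  refine Finset.sum_le_sum fun i _ => ?_
  rw [blk_sub, blk_sub, ← mul_pow]
  exact pow_le_pow_left₀ (frob_nonneg _) ((hR i).dist_le (hT i) hs (hY i)) 2

/-- Optimal rotational alignment. -/
lemma exists_aligned {N : Type*} [Fintype N] {X Y : Matrix N (Fin d) ℝ}
    {Q₀ : Matrix (Fin d) (Fin d) ℝ} (hQ₀ : IsOrth Q₀) {r : ℝ} (h : frob (X - Y * Q₀) ≤ r) :
    ∃ Q : Matrix (Fin d) (Fin d) ℝ, IsOrth Q ∧ frob (X - Y * Q) ≤ r ∧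
      (Xᵀ * (Y * Q))ᵀ = Xᵀ * (Y * Q) := by
  obtain ⟨Q, hQ⟩ := exists_isPolar (Yᵀ * X)
  refine ⟨Q, hQ.1, le_trans ?_ h, ?_⟩
  · refine le_of_sq_le (frob_nonneg _) ?_
    rw [frob_sub_sq, frob_sub_sq, frob_mul_orth hQ.1, frob_mul_orth hQ₀]
    have := (isPolar_iff.1 hQ).2 _ hQ₀
    rw [trace_transpose_mul_comm X, trace_transpose_mul_comm X, transpose_mul, transpose_mul,
      Matrix.mul_assoc, Matrix.mul_assoc]
    linarith
  · have := hQ.symm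
    rw [← Matrix.mul_assoc, ← transpose_mul] at this
    rw [transpose_mul, transpose_transpose, ← this, transpose_mul, transpose_transpose]

/-- The component along `Z` of the difference of two aligned points is of second order. -/
lemma frob_ZStack_transpose_mul_sub_le {X Y : Matrix (Fin n × Fin d) (Fin d) ℝ}
    (hX : OrthBlocks X) (hY : OrthBlocks Y) {P : Matrix (Fin d) (Fin d) ℝ} (hP : IsOrth P)
    {e : ℝ} (he : frob (Y - ZStack n d * P) ≤ e) (hsym : (Xᵀ * Y)ᵀ = Xᵀ * Y) :
    frob ((ZStack n d)ᵀ * (X - Y)) ≤ (e + frob (X - Y) / 2) * frob (X - Y) := by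
  have h1 : frob ((ZStack n d)ᵀ * (X - Y)) = frob ((ZStack n d * P)ᵀ * (X - Y)) := by
    rw [transpose_mul, Matrix.mul_assoc,
      frob_mul_of_transpose_mul (Q := Pᵀ) (by simpa using hP.2)]
  have h2 : (ZStack n d * P)ᵀ * (X - Y) =
      -((Y - ZStack n d * P)ᵀ * (X - Y)) - (1 / 2 : ℝ) • ((X - Y)ᵀ * (X - Y)) := by
    have e1 : Yᵀ * X = Xᵀ * Y := by rw [← hsym, transpose_mul, transpose_transpose]
    simp only [transpose_sub, Matrix.sub_mul, Matrix.mul_sub, hX.transpose_mul_self,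
      hY.transpose_mul_self, e1]
    module
  rw [h1, h2]
  refine (frob_sub_le _ _).trans ?_
  rw [frob_neg, frob_smul]
  have h3 := frob_mul_le (opLe_frob (Y - ZStack n d * P)).transpose (X - Y)
  have h4 := frob_mul_le (opLe_frob (X - Y)).transpose (X - Y)
  have h5 := mul_le_mul_of_nonneg_right he (frob_nonneg (X - Y))
  rw [abs_of_pos (by norm_num)]
  nlinarith

/-- Second-order bound on the overlap defect of an aligned point. -/
lemma frob_ZStack_transpose_mul_sub_smul_le {Y : Matrix (Fin n × Fin d) (Fin d) ℝ}
    (hY : OrthBlocks Y) {P : Matrix (Fin d) (Fin d) ℝ} (hP : IsOrth P)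
    (hsym : (Yᵀ * (ZStack n d * P))ᵀ = Yᵀ * (ZStack n d * P)) :
    frob ((ZStack n d)ᵀ * Y - (n : ℝ) • P) ≤ frob (Y - ZStack n d * P) ^ 2 / 2 := by
  have hZ : OrthBlocks (ZStack n d * P) := orthBlocks_ZStack.mul hP
  have h := frob_ZStack_transpose_mul_sub_le hY hZ hP (e := 0) (by simp [frob_zero]) hsym
  rw [Matrix.mul_sub, ← Matrix.mul_assoc, orthBlocks_ZStack.transpose_mul_self, Matrix.smul_mul,
    Matrix.one_mul] at h
  linarith

/-- The data matrix `ZA + σW`. -/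
noncomputable def dataMat (A : Matrix (Fin d) (Fin m) ℝ) (σ : ℝ)
    (W : Matrix (Fin n × Fin d) (Fin m) ℝ) : Matrix (Fin n × Fin d) (Fin m) ℝ :=
  ZStack n d * A + σ • W

lemma blk_dataMat (A : Matrix (Fin d) (Fin m) ℝ) (σ : ℝ)
    (W : Matrix (Fin n × Fin d) (Fin m) ℝ) (i : Fin n) :
    blk (dataMat A σ W) i = A + σ • blk W i := by
  rw [dataMat, blk_add, blk_mul, blk_smul, blk_ZStack, Matrix.one_mul]

lemma frob_noise_mul_le {A : Matrix (Fin d) (Fin m) ℝ} {W : Matrix (Fin n × Fin d) (Fin m) ℝ}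
    {σ a w : ℝ} (hσ : 0 ≤ σ) (hA : OpLe A a) (hW : OpLe W w)
    (V : Matrix (Fin n × Fin d) (Fin k) ℝ) :
    frob (dataMat A σ W * (dataMat A σ W)ᵀ * V - ZStack n d * A * Aᵀ * (ZStack n d)ᵀ * V) ≤
      (2 * σ * √(n : ℝ) * a * w + σ ^ 2 * w ^ 2) * frob V := by
  have hZ : OpLe (ZStack n d) √(n : ℝ) := orthBlocks_ZStack.opLe
  have e : dataMat A σ W * (dataMat A σ W)ᵀ * V - ZStack n d * A * Aᵀ * (ZStack n d)ᵀ * V =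
      σ • (ZStack n d * A * Wᵀ * V) + σ • (W * (Aᵀ * (ZStack n d)ᵀ) * V) +
        (σ * σ) • (W * Wᵀ * V) := by
    simp only [dataMat, transpose_add, transpose_mul, transpose_smul, Matrix.add_mul,
      Matrix.mul_add, Matrix.smul_mul, Matrix.mul_smul, smul_smul, Matrix.mul_assoc, smul_add]
    abel
  rw [e]
  refine (frob_add_le _ _).trans ?_
  have h1 := frob_add_le (σ • (ZStack n d * A * Wᵀ * V)) (σ • (W * (Aᵀ * (ZStack n d)ᵀ) * V))
  have h2 := frob_mul_le ((hZ.mul hA).mul hW.transpose) V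
  have h3 := frob_mul_le (hW.mul (hA.transpose.mul hZ.transpose)) V
  have h4 := frob_mul_le (hW.mul hW.transpose) V
  rw [frob_smul, frob_smul, abs_of_nonneg hσ] at h1
  rw [frob_smul, abs_of_nonneg (mul_nonneg hσ hσ)]
  have h2' := mul_le_mul_of_nonneg_left h2 hσ
  have h3' := mul_le_mul_of_nonneg_left h3 hσ
  have h4' := mul_le_mul_of_nonneg_left h4 (mul_nonneg hσ hσ)
  calc _ ≤ σ * (√(n : ℝ) * a * w * frob V) + σ * (w * (a * √(n : ℝ)) * frob V) +
        σ * σ * (w * w * frob V) := by linarith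
    _ = _ := by ring

lemma frob_gram_mul_le {A : Matrix (Fin d) (Fin m) ℝ} {W : Matrix (Fin n × Fin d) (Fin m) ℝ}
    {σ a w : ℝ} (hσ : 0 ≤ σ) (hA : OpLe A a) (hW : OpLe W w)
    (V : Matrix (Fin n × Fin d) (Fin k) ℝ) :
    frob (dataMat A σ W * (dataMat A σ W)ᵀ * V) ≤
      √(n : ℝ) * a ^ 2 * frob ((ZStack n d)ᵀ * V) +
        (2 * σ * √(n : ℝ) * a * w + σ ^ 2 * w ^ 2) * frob V := by
  have h1 := frob_noise_mul_le hσ hA hW V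
  have h2 := frob_mul_le ((orthBlocks_ZStack (n := n).opLe.mul hA).mul hA.transpose)
    ((ZStack n d)ᵀ * V)
  rw [← Matrix.mul_assoc] at h2
  have h3 := frob_add_le
    (dataMat A σ W * (dataMat A σ W)ᵀ * V - ZStack n d * A * Aᵀ * (ZStack n d)ᵀ * V)
    (ZStack n d * A * Aᵀ * (ZStack n d)ᵀ * V)
  rw [sub_add_cancel] at h3
  have h4 : √(n : ℝ) * a * a * frob ((ZStack n d)ᵀ * V) =
    √(n : ℝ) * a ^ 2 * frob ((ZStack n d)ᵀ * V) := by ring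
  linarith

end Blocks

section PolarSel

variable {n d m : ℕ}

open Classical in
/-- A choice of polar factor, set to the identity on singular matrices. -/
noncomputable def polarSel (X : Matrix (Fin d) (Fin d) ℝ) : Matrix (Fin d) (Fin d) ℝ :=
  if X.det = 0 then 1 else (exists_isPolar X).choose

lemma isOrth_polarSel (X : Matrix (Fin d) (Fin d) ℝ) : IsOrth (polarSel X) := by
  unfold polarSel
  split_ifs with h
  · exact IsOrth.one
  · exact (exists_isPolar X).choose_spec.1

lemma isPolar_polarSel {X : Matrix (Fin d) (Fin d) ℝ} (h : X.det ≠ 0) :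
    IsPolar X (polarSel X) := by
  rw [polarSel, if_neg h]
  exact (exists_isPolar X).choose_spec

lemma det_ne_zero_of_lower {X : Matrix (Fin d) (Fin d) ℝ} {s : ℝ} (hs : 0 < s)
    (h : ∀ v, s * vnorm v ≤ vnorm (X *ᵥ v)) : X.det ≠ 0 := by
  intro h0
  obtain ⟨v, hv, hXv⟩ := exists_mulVec_eq_zero_iff.2 h0
  have h1 := h v
  rw [hXv, vnorm_zero] at h1
  have h2 : vnorm v = 0 := by nlinarith [vnorm_nonneg v]
  exact hv (vnorm_eq_zero h2)

lemma lower_of_frob_sub_le {α β : Type*} [Fintype α] [Fintype β] {X Y : Matrix α β ℝ} {s r : ℝ}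
    (hY : ∀ v, s * vnorm v ≤ vnorm (Y *ᵥ v)) (h : frob (X - Y) ≤ r) (v : β → ℝ) :
    (s - r) * vnorm v ≤ vnorm (X *ᵥ v) := by
  have h1 := hY v
  have h2 := vnorm_mulVec_le_frob (X - Y) v
  have h3 := vnorm_sub_le (X *ᵥ v) ((X - Y) *ᵥ v)
  rw [← sub_mulVec, sub_sub_cancel] at h3
  have h4 := mul_le_mul_of_nonneg_right h (vnorm_nonneg v)
  linarith

/-- The generalized power iteration for the data matrix `D`, started at the ground truth. -/
noncomputable def oracleSeq (D : Matrix (Fin n × Fin d) (Fin m) ℝ) :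
    ℕ → Matrix (Fin n × Fin d) (Fin d) ℝ
  | 0 => ZStack n d
  | t + 1 => stack fun i => polarSel (blk (D * Dᵀ * oracleSeq D t) i)

lemma orthBlocks_oracleSeq (D : Matrix (Fin n × Fin d) (Fin m) ℝ) (t : ℕ) :
    OrthBlocks (oracleSeq D t) := by
  cases t with
  | zero => exact orthBlocks_ZStack
  | succ t => intro i; rw [oracleSeq, blk_stack]; exact isOrth_polarSel _

lemma isPolarBlocks_oracleSeq {D : Matrix (Fin n × Fin d) (Fin m) ℝ} {t : ℕ} {s : ℝ} (hs : 0 < s)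
    (h : ∀ i v, s * vnorm v ≤ vnorm (blk (D * Dᵀ * oracleSeq D t) i *ᵥ v)) :
    IsPolarBlocks (D * Dᵀ * oracleSeq D t) (oracleSeq D (t + 1)) := by
  intro i
  rw [oracleSeq, blk_stack]
  exact isPolar_polarSel (det_ne_zero_of_lower hs (h i))

end PolarSel

section Deterministic

variable {n d m : ℕ}

/-- The small-noise regime: `s ≤ a` are the extreme singular values, `κ` their ratio, `B` the
noise level and `τ` the blockwise error rate. -/
structure Regime (n d : ℕ) (s a κ σ B τ : ℝ) : Prop where
  one_le_n : 1 ≤ (n : ℝ)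
  one_le_d : 1 ≤ (d : ℝ)
  s_pos : 0 < s
  one_le_κ : 1 ≤ κ
  a_eq : a = κ * s
  σ_pos : 0 < σ
  B_pos : 0 < B
  τ_pos : 0 < τ
  cross : σ * √(n : ℝ) * a * B * √(d : ℝ) = τ * (n * s ^ 2)
  quad : σ ^ 2 * B ^ 2 * √(d : ℝ) ≤ τ * (n * s ^ 2) / 10000
  small : κ ^ 2 * τ ≤ 1 / 10000

namespace Regime

variable {s a κ σ B τ : ℝ}

lemma gap_pos (h : Regime n d s a κ σ B τ) : 0 < n * s ^ 2 :=
  mul_pos (by linarith [h.one_le_n]) (pow_pos h.s_pos 2)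

lemma a_pos (h : Regime n d s a κ σ B τ) : 0 < a := by
  rw [h.a_eq]; exact mul_pos (by linarith [h.one_le_κ]) h.s_pos

lemma one_le_sqrt_n (h : Regime n d s a κ σ B τ) : 1 ≤ √(n : ℝ) := Real.one_le_sqrt.2 h.one_le_n

lemma one_le_sqrt_d (h : Regime n d s a κ σ B τ) : 1 ≤ √(d : ℝ) := Real.one_le_sqrt.2 h.one_le_d

lemma one_le_κ_sq (h : Regime n d s a κ σ B τ) : 1 ≤ κ ^ 2 := one_le_pow₀ h.one_le_κ

lemma τ_le (h : Regime n d s a κ σ B τ) : τ ≤ 1 / 10000 := by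
  nlinarith [h.small, h.one_le_κ_sq, h.τ_pos]

lemma cross_le (h : Regime n d s a κ σ B τ) : σ * √(n : ℝ) * a * B ≤ τ * (n * s ^ 2) := by
  rw [← h.cross]
  have := h.a_pos; have := h.σ_pos; have := h.B_pos
  exact le_mul_of_one_le_right (by positivity) h.one_le_sqrt_d

lemma quad_le (h : Regime n d s a κ σ B τ) :
    σ ^ 2 * B ^ 2 ≤ τ * (n * s ^ 2) / 10000 := by
  refine le_trans ?_ h.quad
  exact le_mul_of_one_le_right (by positivity) h.one_le_sqrt_d

end Regime

variable {A : Matrix (Fin d) (Fin m) ℝ} {W : Matrix (Fin n × Fin d) (Fin m) ℝ}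
  {s a κ σ B τ : ℝ}

/-- The Gram matrix contracts the difference of two aligned points near the ground truth. -/
lemma exists_aligned_gram_le (hR : Regime n d s a κ σ B τ) (hA : OpLe A a) (hW : OpLe W (8 * B))
    {X Y : Matrix (Fin n × Fin d) (Fin d) ℝ} (hX : OrthBlocks X) (hY : OrthBlocks Y)
    {P Q₀ : Matrix (Fin d) (Fin d) ℝ} (hP : IsOrth P) (hQ₀ : IsOrth Q₀) {δ : ℝ}
    (hYZ : frob (Y - ZStack n d * P) ≤ 100 * τ * √(n : ℝ))
    (hXY : frob (X - Y * Q₀) ≤ δ) (hδ : κ ^ 2 * δ ≤ √(n : ℝ) / 8) :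
    ∃ Q : Matrix (Fin d) (Fin d) ℝ, IsOrth Q ∧ frob (X - Y * Q) ≤ δ ∧
      frob (dataMat A σ W * (dataMat A σ W)ᵀ * (X - Y * Q)) ≤ n * s ^ 2 / 8 * δ := by
  obtain ⟨Q, hQ, hQδ, hsym⟩ := exists_aligned hQ₀ hXY
  refine ⟨Q, hQ, hQδ, ?_⟩
  have hYZ' : frob (Y * Q - ZStack n d * (P * Q)) ≤ 100 * τ * √(n : ℝ) := by
    rwa [← Matrix.mul_assoc, ← Matrix.sub_mul, frob_mul_orth hQ]
  have h1 := frob_ZStack_transpose_mul_sub_le hX (hY.mul hQ) (hP.mul hQ) hYZ' hsym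
  have h2 := frob_gram_mul_le hR.σ_pos.le hA hW (X - Y * Q)
  set f := frob (X - Y * Q)
  have hf : 0 ≤ f := frob_nonneg _
  have hn := hR.one_le_sqrt_n
  have hn2 : √(n : ℝ) * √(n : ℝ) = n := Real.mul_self_sqrt (Nat.cast_nonneg n)
  have hgap := hR.gap_pos
  have h3 : √(n : ℝ) * a ^ 2 * frob ((ZStack n d)ᵀ * (X - Y * Q)) ≤
      √(n : ℝ) * a ^ 2 * ((100 * τ * √(n : ℝ) + f / 2) * f) :=
    mul_le_mul_of_nonneg_left h1 (by positivity)
  have h4 : √(n : ℝ) * a ^ 2 * (100 * τ * √(n : ℝ) + f / 2) ≤ 29 / 400 * (n * s ^ 2) := by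
    have e : √(n : ℝ) * a ^ 2 * (100 * τ * √(n : ℝ) + f / 2) =
        s ^ 2 * (100 * (κ ^ 2 * τ) * (√(n : ℝ) * √(n : ℝ)) + √(n : ℝ) * (κ ^ 2 * f) / 2) := by
      rw [hR.a_eq]; ring
    have h5 : κ ^ 2 * f ≤ √(n : ℝ) / 8 :=
      (mul_le_mul_of_nonneg_left hQδ (sq_nonneg κ)).trans hδ
    have h6 : √(n : ℝ) * (κ ^ 2 * f) ≤ n / 8 := by
      calc √(n : ℝ) * (κ ^ 2 * f) ≤ √(n : ℝ) * (√(n : ℝ) / 8) :=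
            mul_le_mul_of_nonneg_left h5 (by positivity)
        _ = n / 8 := by rw [← mul_div_assoc, hn2]
    have h7 : 100 * (κ ^ 2 * τ) * (n : ℝ) ≤ 1 / 100 * n :=
      mul_le_mul_of_nonneg_right (by linarith [hR.small]) (Nat.cast_nonneg n)
    rw [e, hn2]
    have h8 : 100 * (κ ^ 2 * τ) * (n : ℝ) + √(n : ℝ) * (κ ^ 2 * f) / 2 ≤ 29 / 400 * n := by
      linarith
    calc _ ≤ s ^ 2 * (29 / 400 * n) := mul_le_mul_of_nonneg_left h8 (sq_nonneg s)
      _ = _ := by ring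
  have h9 : 2 * σ * √(n : ℝ) * a * (8 * B) + σ ^ 2 * (8 * B) ^ 2 ≤ 1 / 100 * (n * s ^ 2) := by
    have := hR.cross_le
    have := hR.quad_le
    have := mul_le_mul_of_nonneg_right hR.τ_le hgap.le
    nlinarith
  calc _ ≤ (√(n : ℝ) * a ^ 2 * (100 * τ * √(n : ℝ) + f / 2)) * f +
        (2 * σ * √(n : ℝ) * a * (8 * B) + σ ^ 2 * (8 * B) ^ 2) * f := by linarith
    _ ≤ (29 / 400 * (n * s ^ 2)) * f + (1 / 100 * (n * s ^ 2)) * f :=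
        add_le_add (mul_le_mul_of_nonneg_right h4 hf) (mul_le_mul_of_nonneg_right h9 hf)
    _ ≤ n * s ^ 2 / 8 * f := by nlinarith [mul_nonneg hgap.le hf]
    _ ≤ n * s ^ 2 / 8 * δ := mul_le_mul_of_nonneg_left hQδ (by positivity)

lemma gpm_contraction (hR : Regime n d s a κ σ B τ) (hA : OpLe A a) (hW : OpLe W (8 * B))
    {X Y X' Y' : Matrix (Fin n × Fin d) (Fin d) ℝ} (hX : OrthBlocks X) (hY : OrthBlocks Y)
    {P Q₀ : Matrix (Fin d) (Fin d) ℝ} (hP : IsOrth P) (hQ₀ : IsOrth Q₀) {δ : ℝ}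
    (hYZ : frob (Y - ZStack n d * P) ≤ 100 * τ * √(n : ℝ))
    (hXY : frob (X - Y * Q₀) ≤ δ) (hδ : κ ^ 2 * δ ≤ √(n : ℝ) / 8)
    (hX' : IsPolarBlocks (dataMat A σ W * (dataMat A σ W)ᵀ * X) X')
    (hY' : IsPolarBlocks (dataMat A σ W * (dataMat A σ W)ᵀ * Y) Y')
    (hlow : ∀ i v, n * s ^ 2 / 2 * vnorm v ≤
      vnorm (blk (dataMat A σ W * (dataMat A σ W)ᵀ * Y) i *ᵥ v)) :
    ∃ Q : Matrix (Fin d) (Fin d) ℝ, IsOrth Q ∧ frob (X' - Y' * Q) ≤ δ / 2 := by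
  obtain ⟨Q, hQ, -, hC⟩ := exists_aligned_gram_le hR hA hW hX hY hP hQ₀ hYZ hXY hδ
  refine ⟨Q, hQ, ?_⟩
  have hgap := hR.gap_pos
  have h1 := IsPolarBlocks.dist_le hX' (hY'.mul_right hQ) (half_pos hgap) (fun i v => by
    rw [blk_mul, ← mulVec_mulVec, ← vnorm_mulVec_of_transpose_mul hQ.1 v]
    exact hlow i _)
  rw [Matrix.mul_assoc _ Y Q, ← Matrix.mul_sub] at h1
  have h2 : 2 / (n * s ^ 2 / 2) * (n * s ^ 2 / 8 * δ) = δ / 2 := by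
    generalize (n : ℝ) * s ^ 2 = N at hgap
    have := hgap.ne'
    field_simp
    norm_num
  rw [← h2]
  exact h1.trans (mul_le_mul_of_nonneg_left hC (by positivity))

end Deterministic

section Blockwise

variable {n d m : ℕ} {A : Matrix (Fin d) (Fin m) ℝ} {W : Matrix (Fin n × Fin d) (Fin m) ℝ}
  {s a κ σ B τ : ℝ}

lemma gram_lower (hs : 0 < s) (hA : ∀ u, s * vnorm u ≤ vnorm (Aᵀ *ᵥ u)) (u : Fin d → ℝ) :
    s ^ 2 * vnorm u ≤ vnorm ((A * Aᵀ) *ᵥ u) := by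
  have h1 := vnorm_mulVec_sq Aᵀ u
  rw [transpose_transpose] at h1
  have h2 := dot_le_vnorm u ((A * Aᵀ) *ᵥ u)
  have h3 : (s * vnorm u) ^ 2 ≤ vnorm (Aᵀ *ᵥ u) ^ 2 :=
    pow_le_pow_left₀ (mul_nonneg hs.le (vnorm_nonneg u)) (hA u) 2
  rcases (vnorm_nonneg u).eq_or_lt with h0 | h0
  · rw [← h0, mul_zero]; exact vnorm_nonneg _
  · refine le_of_mul_le_mul_left ?_ h0
    nlinarith

lemma isPolar_gram (A : Matrix (Fin d) (Fin m) ℝ) : IsPolar (A * Aᵀ) 1 := by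
  refine isPolar_iff.2 ⟨IsOrth.one, fun Q hQ => ?_⟩
  rw [transpose_one, Matrix.one_mul]
  have h := trace_le_frob Aᵀ (Aᵀ * Q)
  rw [frob_mul_orth hQ, ← sq, frob_sq_eq_trace, transpose_transpose] at h
  rwa [trace_transpose_mul_comm, transpose_mul, transpose_transpose, Matrix.mul_assoc]

lemma IsPolar.smul {X R : Matrix (Fin d) (Fin d) ℝ} (h : IsPolar X R) {c : ℝ} (hc : 0 ≤ c) :
    IsPolar (c • X) R := by
  rw [isPolar_iff] at h ⊢
  refine ⟨h.1, fun Q hQ => ?_⟩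
  rw [Matrix.mul_smul, Matrix.mul_smul, trace_smul, trace_smul]
  exact mul_le_mul_of_nonneg_left (h.2 Q hQ) hc

lemma blk_gram_mul {k : ℕ} (D E : Matrix (Fin n × Fin d) (Fin m) ℝ)
    (T : Matrix (Fin n × Fin d) (Fin k) ℝ) (i : Fin n) :
    blk (D * Eᵀ * T) i = blk D i * (Eᵀ * T) := by
  rw [Matrix.mul_assoc]
  rfl

/-- High-probability bounds on the noise, apart from those involving the iterates. -/
structure NoiseBound (A : Matrix (Fin d) (Fin m) ℝ) (W : Matrix (Fin n × Fin d) (Fin m) ℝ)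
    (s a B : ℝ) : Prop where
  lower : ∀ u, s * vnorm u ≤ vnorm (Aᵀ *ᵥ u)
  upper : OpLe A a
  noise : OpLe W (8 * B)
  row : ∀ i, √(n : ℝ) * frob (blk W i * Aᵀ) ≤ 16 * a * B * √(d : ℝ)

lemma exists_blk_gram_approx (hR : Regime n d s a κ σ B τ) (hN : NoiseBound A W s a B)
    {T : Matrix (Fin n × Fin d) (Fin d) ℝ} (hT : OrthBlocks T)
    {Q₀ : Matrix (Fin d) (Fin d) ℝ} (hQ₀ : IsOrth Q₀)
    (hTZ : frob (T - ZStack n d * Q₀) ≤ 100 * τ * √(n : ℝ))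
    (hω : ∀ i, frob (blk W i * Wᵀ * T) ≤ 256 * √(d : ℝ) * B ^ 2) :
    ∃ Q : Matrix (Fin d) (Fin d) ℝ, IsOrth Q ∧ ∀ i,
      frob (blk (dataMat A σ W * (dataMat A σ W)ᵀ * T) i - (n : ℝ) • (A * Aᵀ * Q)) ≤
        25 * τ * (n * s ^ 2) := by
  obtain ⟨Q, hQ, hQT, hsym⟩ := exists_aligned hQ₀ hTZ
  refine ⟨Q, hQ, fun i => ?_⟩
  have hn2 : √(n : ℝ) * √(n : ℝ) = n := Real.mul_self_sqrt (Nat.cast_nonneg n)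
  have e : blk (dataMat A σ W * (dataMat A σ W)ᵀ * T) i - (n : ℝ) • (A * Aᵀ * Q) =
      A * Aᵀ * ((ZStack n d)ᵀ * T - (n : ℝ) • Q) + σ • (A * Wᵀ * T) +
        σ • (blk W i * Aᵀ * ((ZStack n d)ᵀ * T)) + (σ * σ) • (blk W i * Wᵀ * T) := by
    rw [blk_gram_mul, blk_dataMat]
    simp only [dataMat, transpose_add, transpose_mul, transpose_smul, Matrix.add_mul,
      Matrix.mul_add, Matrix.smul_mul, Matrix.mul_smul, smul_smul, Matrix.mul_assoc, smul_add,
      Matrix.mul_sub]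
    abel
  rw [e]
  have hσ := hR.σ_pos
  have ha := hR.a_pos
  have hgap := hR.gap_pos
  have hτ := hR.τ_pos
  have t1 := frob_add_le (A * Aᵀ * ((ZStack n d)ᵀ * T - (n : ℝ) • Q) + σ • (A * Wᵀ * T) +
        σ • (blk W i * Aᵀ * ((ZStack n d)ᵀ * T))) ((σ * σ) • (blk W i * Wᵀ * T))
  have t2 := frob_add_le (A * Aᵀ * ((ZStack n d)ᵀ * T - (n : ℝ) • Q) + σ • (A * Wᵀ * T))
        (σ • (blk W i * Aᵀ * ((ZStack n d)ᵀ * T)))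
  have t3 := frob_add_le (A * Aᵀ * ((ZStack n d)ᵀ * T - (n : ℝ) • Q)) (σ • (A * Wᵀ * T))
  rw [frob_smul, abs_of_pos hσ] at t2 t3
  rw [frob_smul, abs_of_pos (mul_pos hσ hσ)] at t1
  have p1 : frob (A * Aᵀ * ((ZStack n d)ᵀ * T - (n : ℝ) • Q)) ≤ τ * (n * s ^ 2) / 2 := by
    have h1 := frob_mul_le (hN.upper.mul hN.upper.transpose) ((ZStack n d)ᵀ * T - (n : ℝ) • Q)
    have h2 := frob_ZStack_transpose_mul_sub_smul_le hT hQ hsym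
    have h3 : frob (T - ZStack n d * Q) ^ 2 ≤ (100 * τ * √(n : ℝ)) ^ 2 :=
      pow_le_pow_left₀ (frob_nonneg _) hQT 2
    have h4 : a * a * frob ((ZStack n d)ᵀ * T - (n : ℝ) • Q) ≤
        a * a * ((100 * τ * √(n : ℝ)) ^ 2 / 2) :=
      mul_le_mul_of_nonneg_left (by linarith) (by positivity)
    have h5 : a * a * ((100 * τ * √(n : ℝ)) ^ 2 / 2) =
        5000 * (κ ^ 2 * τ) * (τ * (s ^ 2 * (√(n : ℝ) * √(n : ℝ)))) := by rw [hR.a_eq]; ring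
    have h6 : 5000 * (κ ^ 2 * τ) * (τ * (s ^ 2 * (√(n : ℝ) * √(n : ℝ)))) ≤
        1 / 2 * (τ * (s ^ 2 * (√(n : ℝ) * √(n : ℝ)))) :=
      mul_le_mul_of_nonneg_right (by linarith [hR.small]) (by positivity)
    rw [hn2] at h5 h6
    linarith
  have p2 : σ * frob (A * Wᵀ * T) ≤ 8 * (τ * (n * s ^ 2)) := by
    have h1 := frob_mul_le (hN.upper.mul hN.noise.transpose) T
    rw [hT.frob_eq] at h1
    calc _ ≤ σ * (a * (8 * B) * (√(n : ℝ) * √(d : ℝ))) := mul_le_mul_of_nonneg_left h1 hσ.le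
      _ = 8 * (σ * √(n : ℝ) * a * B * √(d : ℝ)) := by ring
      _ = _ := by rw [hR.cross]
  have p3 : σ * frob (blk W i * Aᵀ * ((ZStack n d)ᵀ * T)) ≤ 16 * (τ * (n * s ^ 2)) := by
    have h1 := frob_mul_le_right (orthBlocks_ZStack.opLe.transpose.mul hT.opLe) (blk W i * Aᵀ)
    have h2 := mul_le_mul_of_nonneg_left (hN.row i) (Real.sqrt_nonneg (n : ℝ))
    calc _ ≤ σ * (√(n : ℝ) * √(n : ℝ) * frob (blk W i * Aᵀ)) :=
          mul_le_mul_of_nonneg_left h1 hσ.le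
      _ ≤ σ * (√(n : ℝ) * (16 * a * B * √(d : ℝ))) :=
          mul_le_mul_of_nonneg_left (by linarith) hσ.le
      _ = 16 * (σ * √(n : ℝ) * a * B * √(d : ℝ)) := by ring
      _ = _ := by rw [hR.cross]
  have p4 : σ * σ * frob (blk W i * Wᵀ * T) ≤ τ * (n * s ^ 2) / 2 := by
    calc _ ≤ σ * σ * (256 * √(d : ℝ) * B ^ 2) :=
          mul_le_mul_of_nonneg_left (hω i) (by positivity)
      _ = 256 * (σ ^ 2 * B ^ 2 * √(d : ℝ)) := by ring
      _ ≤ 256 * (τ * (n * s ^ 2) / 10000) := mul_le_mul_of_nonneg_left hR.quad (by norm_num)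
      _ ≤ _ := by linarith [mul_pos hτ hgap]
  linarith

lemma gram_step (hR : Regime n d s a κ σ B τ) (hN : NoiseBound A W s a B)
    {T : Matrix (Fin n × Fin d) (Fin d) ℝ} (hT : OrthBlocks T)
    {Q₀ : Matrix (Fin d) (Fin d) ℝ} (hQ₀ : IsOrth Q₀)
    (hTZ : frob (T - ZStack n d * Q₀) ≤ 100 * τ * √(n : ℝ))
    (hω : ∀ i, frob (blk W i * Wᵀ * T) ≤ 256 * √(d : ℝ) * B ^ 2) :
    (∀ i v, n * s ^ 2 / 2 * vnorm v ≤
      vnorm (blk (dataMat A σ W * (dataMat A σ W)ᵀ * T) i *ᵥ v)) ∧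
    ∀ T', IsPolarBlocks (dataMat A σ W * (dataMat A σ W)ᵀ * T) T' →
      ∃ Q : Matrix (Fin d) (Fin d) ℝ, IsOrth Q ∧ ∀ i, frob (blk T' i - Q) ≤ 100 * τ := by
  obtain ⟨Q, hQ, hblk⟩ := exists_blk_gram_approx hR hN hT hQ₀ hTZ hω
  have hgap := hR.gap_pos
  have hlow : ∀ v, n * s ^ 2 * vnorm v ≤ vnorm (((n : ℝ) • (A * Aᵀ * Q)) *ᵥ v) := fun v => by
    have h1 := gram_lower hR.s_pos hN.lower (Q *ᵥ v)
    rw [vnorm_mulVec_of_transpose_mul hQ.1 v, mulVec_mulVec] at h1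
    rw [smul_mulVec, vnorm_smul, abs_of_nonneg (Nat.cast_nonneg n), mul_assoc]
    exact mul_le_mul_of_nonneg_left h1 (Nat.cast_nonneg n)
  refine ⟨fun i v => ?_, fun T' hT' => ⟨Q, hQ, fun i => ?_⟩⟩
  · have h1 := lower_of_frob_sub_le hlow (hblk i) v
    refine le_trans (mul_le_mul_of_nonneg_right ?_ (vnorm_nonneg v)) h1
    have := mul_le_mul_of_nonneg_right hR.τ_le hgap.le
    linarith
  · have hpol : IsPolar ((n : ℝ) • (A * Aᵀ * Q)) Q := by
      have := ((isPolar_gram A).mul_right hQ).smul (Nat.cast_nonneg n)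
      rwa [Matrix.one_mul] at this
    have h1 := (hT' i).dist_le hpol hgap hlow
    have h2 : 2 / (n * s ^ 2) * (25 * τ * (n * s ^ 2)) = 50 * τ := by
      generalize (n : ℝ) * s ^ 2 = N at hgap
      have := hgap.ne'
      field_simp
      ring
    have h3 := mul_le_mul_of_nonneg_left (hblk i) (show 0 ≤ 2 / (n * s ^ 2) by positivity)
    have := hR.τ_pos
    linarith

end Blockwise

section LeaveOneOut

variable {n d m k : ℕ} {A : Matrix (Fin d) (Fin m) ℝ} {W : Matrix (Fin n × Fin d) (Fin m) ℝ}
  {s a κ σ B τ : ℝ}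

lemma blk_sub_mask (W : Matrix (Fin n × Fin d) (Fin m) ℝ) (i j : Fin n) :
    blk (W - mask W i) j = if j = i then blk W i else 0 := by
  ext a b
  by_cases h : j = i
  · subst h; simp [blk, mask]
  · simp [blk, mask, h]

lemma sub_mask_transpose_mul (W : Matrix (Fin n × Fin d) (Fin m) ℝ) (i : Fin n)
    (T : Matrix (Fin n × Fin d) (Fin k) ℝ) :
    (W - mask W i)ᵀ * T = (blk W i)ᵀ * blk T i := by
  rw [transpose_mul_eq_sum_blk, Finset.sum_eq_single i]
  · rw [blk_sub_mask, if_pos rfl]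
  · intro j _ hj
    rw [blk_sub_mask, if_neg hj, transpose_zero, Matrix.zero_mul]
  · simp

lemma frob_sub_mask_mul (W : Matrix (Fin n × Fin d) (Fin m) ℝ) (i : Fin n)
    (X : Matrix (Fin m) (Fin k) ℝ) : frob ((W - mask W i) * X) = frob (blk W i * X) := by
  rw [← Real.sqrt_sq (frob_nonneg ((W - mask W i) * X)), ← Real.sqrt_sq (frob_nonneg (blk W i * X)),
    frob_sq_blk, Finset.sum_eq_single i]
  · rw [blk_mul, blk_sub_mask, if_pos rfl]
  · intro j _ hj
    rw [blk_mul, blk_sub_mask, if_neg hj, Matrix.zero_mul, frob_zero, sq, mul_zero]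
  · simp

lemma OpLe.blk {W : Matrix (Fin n × Fin d) (Fin m) ℝ} {w : ℝ} (h : OpLe W w) (i : Fin n) :
    OpLe (blk W i) w := by
  refine ⟨h.1, fun v => le_trans (le_of_sq_le (vnorm_nonneg _) ?_) (h.2 v)⟩
  rw [vnorm_sq, vnorm_sq, Fintype.sum_prod_type]
  exact Finset.single_le_sum (f := fun j => ∑ a, ((W *ᵥ v) (j, a)) ^ 2)
    (fun _ _ => Finset.sum_nonneg fun _ _ => sq_nonneg _) (Finset.mem_univ i)

lemma frob_blk_transpose_mul_le (hW : OpLe W (8 * B)) {T : Matrix (Fin n × Fin d) (Fin d) ℝ}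
    (hT : OrthBlocks T) (i : Fin n) :
    frob ((blk W i)ᵀ * GOPP.blk T i) ≤ 8 * B * √(d : ℝ) := by
  rw [frob_mul_orth (hT i)]
  simpa using frob_le_of_opLe (hW.blk i).transpose

lemma frob_sub_mask_gram_le (hR : Regime n d s a κ σ B τ) (hN : NoiseBound A W s a B)
    {T : Matrix (Fin n × Fin d) (Fin d) ℝ} (hT : OrthBlocks T) (i : Fin n)
    (hω : frob (blk W i * ((mask W i)ᵀ * T)) ≤ 128 * √(d : ℝ) * B ^ 2) :
    frob (dataMat A σ W * (dataMat A σ W)ᵀ * T -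
      dataMat A σ (mask W i) * (dataMat A σ (mask W i))ᵀ * T) ≤ 33 * τ * (n * s ^ 2) := by
  have hσ := hR.σ_pos
  have hB := hR.B_pos
  have ha := hR.a_pos
  have hn2 : √(n : ℝ) * √(n : ℝ) = n := Real.mul_self_sqrt (Nat.cast_nonneg n)
  have e : dataMat A σ W * (dataMat A σ W)ᵀ * T -
      dataMat A σ (mask W i) * (dataMat A σ (mask W i))ᵀ * T =
      σ • (ZStack n d * (A * (blk W i)ᵀ * blk T i)) +
        (σ * σ) • (W * ((blk W i)ᵀ * blk T i)) +
        σ • ((W - mask W i) * (Aᵀ * ((ZStack n d)ᵀ * T))) +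
        (σ * σ) • ((W - mask W i) * ((mask W i)ᵀ * T)) := by
    rw [Matrix.mul_assoc A, ← sub_mask_transpose_mul]
    simp only [dataMat, transpose_add, transpose_mul, transpose_smul, Matrix.add_mul,
      Matrix.mul_add, Matrix.smul_mul, Matrix.mul_smul, smul_smul, Matrix.mul_assoc, smul_add,
      Matrix.mul_sub, Matrix.sub_mul, smul_sub, transpose_sub]
    abel
  rw [e]
  have t1 := frob_add_le (σ • (ZStack n d * (A * (blk W i)ᵀ * blk T i)) +
        (σ * σ) • (W * ((blk W i)ᵀ * blk T i)) +
        σ • ((W - mask W i) * (Aᵀ * ((ZStack n d)ᵀ * T))))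
        ((σ * σ) • ((W - mask W i) * ((mask W i)ᵀ * T)))
  have t2 := frob_add_le (σ • (ZStack n d * (A * (blk W i)ᵀ * blk T i)) +
        (σ * σ) • (W * ((blk W i)ᵀ * blk T i)))
        (σ • ((W - mask W i) * (Aᵀ * ((ZStack n d)ᵀ * T))))
  have t3 := frob_add_le (σ • (ZStack n d * (A * (blk W i)ᵀ * blk T i)))
        ((σ * σ) • (W * ((blk W i)ᵀ * blk T i)))
  rw [frob_smul, abs_of_pos (mul_pos hσ hσ), frob_sub_mask_mul] at t1
  rw [frob_smul σ, abs_of_pos hσ, frob_sub_mask_mul] at t2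
  rw [frob_smul, frob_smul, abs_of_pos (mul_pos hσ hσ), abs_of_pos hσ] at t3
  have p1 : σ * frob (ZStack n d * (A * (blk W i)ᵀ * blk T i)) ≤ 16 * (τ * (n * s ^ 2)) := by
    have h1 := frob_mul_le (orthBlocks_ZStack (n := n)).opLe (A * (blk W i)ᵀ * blk T i)
    rw [frob_mul_orth (hT i), ← frob_transpose (A * (blk W i)ᵀ), transpose_mul,
      transpose_transpose] at h1
    have h2 := h1.trans (hN.row i)
    calc _ ≤ σ * (16 * a * B * √(d : ℝ)) := mul_le_mul_of_nonneg_left h2 hσ.le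
      _ ≤ σ * (16 * a * B * √(d : ℝ)) * √(n : ℝ) :=
          le_mul_of_one_le_right (by positivity) hR.one_le_sqrt_n
      _ = 16 * (σ * √(n : ℝ) * a * B * √(d : ℝ)) := by ring
      _ = _ := by rw [hR.cross]
  have p2 : σ * σ * frob (W * ((blk W i)ᵀ * blk T i)) ≤ 64 * (τ * (n * s ^ 2) / 10000) := by
    have h1 := frob_mul_le hN.noise ((blk W i)ᵀ * blk T i)
    have h2 := mul_le_mul_of_nonneg_left (frob_blk_transpose_mul_le hN.noise hT i) hN.noise.1
    calc _ ≤ σ * σ * (8 * B * (8 * B * √(d : ℝ))) :=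
          mul_le_mul_of_nonneg_left (h1.trans h2) (by positivity)
      _ = 64 * (σ ^ 2 * B ^ 2 * √(d : ℝ)) := by ring
      _ ≤ _ := mul_le_mul_of_nonneg_left hR.quad (by norm_num)
  have p3 : σ * frob (blk W i * (Aᵀ * ((ZStack n d)ᵀ * T))) ≤ 16 * (τ * (n * s ^ 2)) := by
    have h1 := frob_mul_le_right (orthBlocks_ZStack.opLe.transpose.mul hT.opLe) (blk W i * Aᵀ)
    have h2 := mul_le_mul_of_nonneg_left (hN.row i) (Real.sqrt_nonneg (n : ℝ))
    rw [← Matrix.mul_assoc]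
    calc _ ≤ σ * (√(n : ℝ) * √(n : ℝ) * frob (blk W i * Aᵀ)) :=
          mul_le_mul_of_nonneg_left h1 hσ.le
      _ ≤ σ * (√(n : ℝ) * (16 * a * B * √(d : ℝ))) :=
          mul_le_mul_of_nonneg_left (by linarith) hσ.le
      _ = 16 * (σ * √(n : ℝ) * a * B * √(d : ℝ)) := by ring
      _ = _ := by rw [hR.cross]
  have p4 : σ * σ * frob (blk W i * ((mask W i)ᵀ * T)) ≤ 128 * (τ * (n * s ^ 2) / 10000) := by
    calc _ ≤ σ * σ * (128 * √(d : ℝ) * B ^ 2) :=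
          mul_le_mul_of_nonneg_left hω (by positivity)
      _ = 128 * (σ ^ 2 * B ^ 2 * √(d : ℝ)) := by ring
      _ ≤ _ := mul_le_mul_of_nonneg_left hR.quad (by norm_num)
  linarith [mul_pos hR.τ_pos hR.gap_pos]

lemma frob_blk_noise_gram_le (hR : Regime n d s a κ σ B τ) (hN : NoiseBound A W s a B)
    {T T' : Matrix (Fin n × Fin d) (Fin d) ℝ} (hT' : OrthBlocks T')
    (i : Fin n) (hω : frob (blk W i * ((mask W i)ᵀ * T')) ≤ 128 * √(d : ℝ) * B ^ 2)
    {Q : Matrix (Fin d) (Fin d) ℝ} (hQ : IsOrth Q) (hTT' : frob (T' - T * Q) ≤ 300 * τ) :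
    frob (blk W i * Wᵀ * T) ≤ 256 * √(d : ℝ) * B ^ 2 := by
  have e : blk W i * Wᵀ * T * Q = blk W i * ((mask W i)ᵀ * T') +
      blk W i * ((blk W i)ᵀ * blk T' i) - blk W i * Wᵀ * (T' - T * Q) := by
    rw [← sub_mask_transpose_mul]
    simp only [transpose_sub, Matrix.sub_mul, Matrix.mul_sub, Matrix.mul_assoc]
    abel
  rw [← frob_mul_orth hQ, e]
  have t1 := frob_sub_le (blk W i * ((mask W i)ᵀ * T') + blk W i * ((blk W i)ᵀ * blk T' i))
    (blk W i * Wᵀ * (T' - T * Q))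
  have t2 := frob_add_le (blk W i * ((mask W i)ᵀ * T')) (blk W i * ((blk W i)ᵀ * blk T' i))
  have p1 := frob_mul_le (hN.noise.blk i) ((blk W i)ᵀ * blk T' i)
  have p2 := mul_le_mul_of_nonneg_left (frob_blk_transpose_mul_le hN.noise hT' i) hN.noise.1
  have p3 := frob_mul_le ((hN.noise.blk i).mul hN.noise.transpose) (T' - T * Q)
  have p4 : 8 * B * (8 * B) * frob (T' - T * Q) ≤ 8 * B * (8 * B) * (300 * τ) :=
    mul_le_mul_of_nonneg_left hTT' (mul_nonneg hN.noise.1 hN.noise.1)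
  have p5 : 8 * B * (8 * B) * (300 * τ) ≤ 2 * (√(d : ℝ) * B ^ 2) := by
    have := mul_le_mul_of_nonneg_left hR.τ_le (sq_nonneg B)
    have := mul_le_mul_of_nonneg_right hR.one_le_sqrt_d (sq_nonneg B)
    nlinarith
  have := mul_nonneg (Real.sqrt_nonneg (d : ℝ)) (sq_nonneg B)
  nlinarith

lemma leave_one_out_step (hR : Regime n d s a κ σ B τ) (hN : NoiseBound A W s a B)
    {T T' T₁ : Matrix (Fin n × Fin d) (Fin d) ℝ} (hT : OrthBlocks T) (hT' : OrthBlocks T')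
    (i : Fin n) (hω : frob (blk W i * ((mask W i)ᵀ * T')) ≤ 128 * √(d : ℝ) * B ^ 2)
    {P Q₀ : Matrix (Fin d) (Fin d) ℝ} (hP : IsOrth P) (hQ₀ : IsOrth Q₀)
    (hTZ : frob (T - ZStack n d * P) ≤ 100 * τ * √(n : ℝ))
    (hTT' : frob (T' - T * Q₀) ≤ 300 * τ)
    (hlow : ∀ i v, n * s ^ 2 / 2 * vnorm v ≤
      vnorm (blk (dataMat A σ W * (dataMat A σ W)ᵀ * T) i *ᵥ v))
    (hT₁ : IsPolarBlocks (dataMat A σ W * (dataMat A σ W)ᵀ * T) T₁) :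
    (∀ j v, n * s ^ 2 / 4 * vnorm v ≤ vnorm
      (blk (dataMat A σ (mask W i) * (dataMat A σ (mask W i))ᵀ * T') j *ᵥ v)) ∧
    ∀ T₁', IsPolarBlocks (dataMat A σ (mask W i) * (dataMat A σ (mask W i))ᵀ * T') T₁' →
      ∃ Q : Matrix (Fin d) (Fin d) ℝ, IsOrth Q ∧ frob (T₁' - T₁ * Q) ≤ 300 * τ := by
  have hgap := hR.gap_pos
  have hτ := hR.τ_pos
  obtain ⟨Q, hQ, hQδ, hC⟩ := exists_aligned_gram_le hR hN.upper hN.noise hT' hT hP hQ₀ hTZ hTT'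
    (by linarith [hR.small, hR.one_le_sqrt_n])
  have hE := frob_sub_mask_gram_le hR hN hT' i hω
  set C := dataMat A σ W * (dataMat A σ W)ᵀ
  set C' := dataMat A σ (mask W i) * (dataMat A σ (mask W i))ᵀ
  have hdiff : frob (C' * T' - C * T * Q) ≤ 71 * τ * (n * s ^ 2) := by
    have e : C' * T' - C * T * Q = C * (T' - T * Q) - (C * T' - C' * T') := by
      rw [Matrix.mul_sub, Matrix.mul_assoc C T Q]; abel
    rw [e]
    have := frob_sub_le (C * (T' - T * Q)) (C * T' - C' * T')
    linarith [mul_pos hτ hgap]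
  have hlow' : ∀ i v, n * s ^ 2 / 2 * vnorm v ≤ vnorm (blk (C * T * Q) i *ᵥ v) := fun i v => by
    rw [blk_mul, ← mulVec_mulVec, ← vnorm_mulVec_of_transpose_mul hQ.1 v]
    exact hlow i _
  refine ⟨fun j v => ?_, fun T₁' hT₁' => ⟨Q, hQ, ?_⟩⟩
  · have h1 := lower_of_frob_sub_le (hlow' j) ((frob_blk_le (C' * T' - C * T * Q) j).trans hdiff) v
    refine le_trans (mul_le_mul_of_nonneg_right ?_ (vnorm_nonneg v)) h1
    have := mul_le_mul_of_nonneg_right hR.τ_le hgap.le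
    linarith
  · have h1 := hT₁'.dist_le (hT₁.mul_right hQ) (half_pos hgap) hlow'
    have h2 : 2 / (n * s ^ 2 / 2) * (71 * τ * (n * s ^ 2)) = 284 * τ := by
      generalize (n : ℝ) * s ^ 2 = N at hgap
      have := hgap.ne'
      field_simp
      norm_num
    have h3 := mul_le_mul_of_nonneg_left hdiff (show 0 ≤ 2 / (n * s ^ 2 / 2) by positivity)
    linarith

end LeaveOneOut

section Induction

variable {n d m k : ℕ} {A : Matrix (Fin d) (Fin m) ℝ} {W : Matrix (Fin n × Fin d) (Fin m) ℝ}
  {s a κ σ B τ : ℝ}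

lemma frob_sub_ZStack_mul_le {T : Matrix (Fin n × Fin d) (Fin d) ℝ}
    {Q : Matrix (Fin d) (Fin d) ℝ} {r : ℝ} (hr : 0 ≤ r) (h : ∀ j, frob (blk T j - Q) ≤ r) :
    frob (T - ZStack n d * Q) ≤ r * √(n : ℝ) := by
  rw [mul_comm]
  refine frob_le_of_blk_le hr fun i => ?_
  rw [blk_sub, blk_mul, blk_ZStack, Matrix.one_mul]
  exact h i

/-- The blocks of `T` are all close to one rotation, and `T` is close to each leave-one-out
counterpart `T' i`. -/
def Consistent (τ : ℝ) (T : Matrix (Fin n × Fin d) (Fin d) ℝ)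
    (T' : Fin n → Matrix (Fin n × Fin d) (Fin d) ℝ) : Prop :=
  (∃ Q : Matrix (Fin d) (Fin d) ℝ, IsOrth Q ∧ ∀ j, frob (blk T j - Q) ≤ 100 * τ) ∧
    ∀ i, ∃ Q : Matrix (Fin d) (Fin d) ℝ, IsOrth Q ∧ frob (T' i - T * Q) ≤ 300 * τ

lemma oracle_step (hR : Regime n d s a κ σ B τ) (hN : NoiseBound A W s a B) {t : ℕ}
    (hL : ∀ i, frob (blk W i * ((mask W i)ᵀ * oracleSeq (dataMat A σ (mask W i)) t)) ≤
      128 * √(d : ℝ) * B ^ 2)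
    (hC : Consistent τ (oracleSeq (dataMat A σ W) t)
      fun i => oracleSeq (dataMat A σ (mask W i)) t) :
    (∀ i v, n * s ^ 2 / 2 * vnorm v ≤ vnorm
      (blk (dataMat A σ W * (dataMat A σ W)ᵀ * oracleSeq (dataMat A σ W) t) i *ᵥ v)) ∧
    Consistent τ (oracleSeq (dataMat A σ W) (t + 1))
      fun i => oracleSeq (dataMat A σ (mask W i)) (t + 1) := by
  obtain ⟨⟨P, hP, hPT⟩, hTT'⟩ := hC
  have hT := orthBlocks_oracleSeq (dataMat A σ W) t
  have hTZ := frob_sub_ZStack_mul_le (mul_nonneg (by norm_num) hR.τ_pos.le) hPT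
  obtain ⟨hlow, hnext⟩ := gram_step hR hN hT hP hTZ fun i => by
    obtain ⟨Q, hQ, hQT⟩ := hTT' i
    exact frob_blk_noise_gram_le hR hN (orthBlocks_oracleSeq _ t) i (hL i) hQ hQT
  have hpol := isPolarBlocks_oracleSeq (half_pos hR.gap_pos) hlow
  refine ⟨hlow, hnext _ hpol, fun i => ?_⟩
  obtain ⟨Q, hQ, hQT⟩ := hTT' i
  obtain ⟨hlow', hnext'⟩ := leave_one_out_step hR hN hT (orthBlocks_oracleSeq _ t) i (hL i) hP hQ
    hTZ hQT hlow hpol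
  exact hnext' _ (isPolarBlocks_oracleSeq (div_pos hR.gap_pos (by norm_num)) hlow')

lemma oracle_consistent (hR : Regime n d s a κ σ B τ) (hN : NoiseBound A W s a B)
    (hL : ∀ i, ∀ t ≤ n, frob (blk W i * ((mask W i)ᵀ *
      oracleSeq (dataMat A σ (mask W i)) t)) ≤ 128 * √(d : ℝ) * B ^ 2) :
    ∀ t ≤ n + 1, Consistent τ (oracleSeq (dataMat A σ W) t)
      fun i => oracleSeq (dataMat A σ (mask W i)) t := by
  intro t
  induction t with
  | zero =>
    have := hR.τ_pos
    refine fun _ => ⟨⟨1, IsOrth.one, fun j => ?_⟩, fun i => ⟨1, IsOrth.one, ?_⟩⟩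
    · rw [oracleSeq, blk_ZStack, sub_self, frob_zero]; positivity
    · simp only [oracleSeq, Matrix.mul_one, sub_self, frob_zero]; positivity
  | succ t ih =>
    exact fun ht => (oracle_step hR hN (fun i => hL i t (by omega)) (ih (by omega))).2

lemma oracle_increment (hR : Regime n d s a κ σ B τ) (hN : NoiseBound A W s a B)
    (hL : ∀ i, ∀ t ≤ n, frob (blk W i * ((mask W i)ᵀ *
      oracleSeq (dataMat A σ (mask W i)) t)) ≤ 128 * √(d : ℝ) * B ^ 2) :
    ∀ t ≤ n, ∃ Q : Matrix (Fin d) (Fin d) ℝ, IsOrth Q ∧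
      frob (oracleSeq (dataMat A σ W) (t + 1) - oracleSeq (dataMat A σ W) t * Q) ≤
        100 * τ * √(n : ℝ) / 2 ^ t := by
  have hτ := hR.τ_pos
  have hC := oracle_consistent hR hN hL
  have hlow : ∀ t ≤ n, _ := fun t ht =>
    (oracle_step hR hN (fun i => hL i t ht) (hC t (by omega))).1
  have hpol : ∀ t ≤ n, _ := fun t ht =>
    isPolarBlocks_oracleSeq (half_pos hR.gap_pos) (hlow t ht)
  intro t
  induction t with
  | zero =>
    intro _
    obtain ⟨Q, hQ, h⟩ := (hC 1 (by omega)).1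
    refine ⟨Q, hQ, ?_⟩
    rw [pow_zero, div_one]
    exact frob_sub_ZStack_mul_le (by positivity) h
  | succ t ih =>
    intro ht
    obtain ⟨Q, hQ, h⟩ := ih (by omega)
    obtain ⟨P, hP, hPT⟩ := (hC t (by omega)).1
    rw [pow_succ, ← div_div]
    refine gpm_contraction hR hN.upper hN.noise (orthBlocks_oracleSeq _ _)
      (orthBlocks_oracleSeq _ _) hP hQ (frob_sub_ZStack_mul_le (by positivity) hPT) h ?_
      (hpol (t + 1) ht) (hpol t (by omega)) (hlow t (by omega))
    calc κ ^ 2 * (100 * τ * √(n : ℝ) / 2 ^ t) ≤ κ ^ 2 * (100 * τ * √(n : ℝ)) :=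
          mul_le_mul_of_nonneg_left (div_le_self (by positivity) (one_le_pow₀ (by norm_num)))
            (sq_nonneg κ)
      _ = κ ^ 2 * τ * (100 * √(n : ℝ)) := by ring
      _ ≤ 1 / 10000 * (100 * √(n : ℝ)) :=
          mul_le_mul_of_nonneg_right hR.small (by positivity)
      _ ≤ √(n : ℝ) / 8 := by linarith [Real.sqrt_nonneg (n : ℝ)]

lemma gpm_near_oracle (hR : Regime n d s a κ σ B τ) (hN : NoiseBound A W s a B)
    (hL : ∀ i, ∀ t ≤ n, frob (blk W i * ((mask W i)ᵀ *
      oracleSeq (dataMat A σ (mask W i)) t)) ≤ 128 * √(d : ℝ) * B ^ 2)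
    {S : ℕ → Matrix (Fin n × Fin d) (Fin d) ℝ} (hS₀ : OrthBlocks (S 0))
    (hS : ∀ t, IsPolarBlocks (dataMat A σ W * (dataMat A σ W)ᵀ * S t) (S (t + 1)))
    {δ : ℝ} (hδ : κ ^ 2 * (δ + 200 * τ) ≤ √(n : ℝ) / 8) {Q₀ : Matrix (Fin d) (Fin d) ℝ}
    (hQ₀ : IsOrth Q₀) (hinit : frob (S 0 - oracleSeq (dataMat A σ W) n * Q₀) ≤ δ) (t : ℕ) :
    ∃ Q : Matrix (Fin d) (Fin d) ℝ, IsOrth Q ∧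
      frob (S t - oracleSeq (dataMat A σ W) n * Q) ≤ δ / 2 ^ t + 200 * τ := by
  have hτ := hR.τ_pos
  have hδ0 : 0 ≤ δ := (frob_nonneg _).trans hinit
  have hC := oracle_consistent hR hN hL n (by omega)
  have hlow := (oracle_step hR hN (fun i => hL i n le_rfl) hC).1
  have hpol := isPolarBlocks_oracleSeq (half_pos hR.gap_pos) hlow
  obtain ⟨P, hP, hPT⟩ := hC.1
  obtain ⟨R, hQR, hRT⟩ := oracle_increment hR hN hL n le_rfl
  have hRT' : frob (oracleSeq (dataMat A σ W) (n + 1) - oracleSeq (dataMat A σ W) n * R) ≤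
      100 * τ := by
    refine hRT.trans ((div_le_iff₀ (by positivity)).2 ?_)
    refine mul_le_mul_of_nonneg_left ?_ (by positivity)
    calc √(n : ℝ) ≤ n := Real.sqrt_le_iff.2 ⟨by positivity, by nlinarith [hR.one_le_n]⟩
      _ ≤ 2 ^ n := by exact_mod_cast Nat.lt_two_pow_self.le
  have hSt : ∀ t, OrthBlocks (S t) := fun t => by
    cases t with
    | zero => exact hS₀
    | succ t => exact (hS t).orthBlocks
  induction t with
  | zero => exact ⟨Q₀, hQ₀, by rw [pow_zero, div_one]; linarith⟩
  | succ t ih =>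
    obtain ⟨Q, hQ, h⟩ := ih
    obtain ⟨Q', hQ', h'⟩ := gpm_contraction hR hN.upper hN.noise (hSt t)
      (orthBlocks_oracleSeq _ _) hP hQ (frob_sub_ZStack_mul_le (by positivity) hPT) h
      ((mul_le_mul_of_nonneg_left (by
        have : δ / 2 ^ t ≤ δ := div_le_self hδ0 (one_le_pow₀ (by norm_num))
        linarith) (sq_nonneg κ)).trans hδ) (hS t) hpol hlow
    refine ⟨R * Q', hQR.mul hQ', ?_⟩
    have e : S (t + 1) - oracleSeq (dataMat A σ W) n * (R * Q') =
        (S (t + 1) - oracleSeq (dataMat A σ W) (n + 1) * Q') +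
        (oracleSeq (dataMat A σ W) (n + 1) - oracleSeq (dataMat A σ W) n * R) * Q' := by
      rw [Matrix.sub_mul, Matrix.mul_assoc]; abel
    rw [e, pow_succ, ← div_div]
    have := frob_add_le (S (t + 1) - oracleSeq (dataMat A σ W) (n + 1) * Q')
      ((oracleSeq (dataMat A σ W) (n + 1) - oracleSeq (dataMat A σ W) n * R) * Q')
    rw [frob_mul_orth hQ'] at this
    linarith

lemma limit_blockwise_le (hR : Regime n d s a κ σ B τ) (hN : NoiseBound A W s a B)
    (hL : ∀ i, ∀ t ≤ n, frob (blk W i * ((mask W i)ᵀ *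
      oracleSeq (dataMat A σ (mask W i)) t)) ≤ 128 * √(d : ℝ) * B ^ 2)
    {S : ℕ → Matrix (Fin n × Fin d) (Fin d) ℝ} (hS₀ : OrthBlocks (S 0))
    (hS : ∀ t, IsPolarBlocks (dataMat A σ W * (dataMat A σ W)ᵀ * S t) (S (t + 1)))
    {Q₀ : Matrix (Fin d) (Fin d) ℝ} (hQ₀ : IsOrth Q₀)
    (hinit : frob (S 0 - ZStack n d * Q₀) ≤ 900 * τ * √(n : ℝ))
    {Sinf : Matrix (Fin n × Fin d) (Fin d) ℝ}
    (hlim : Tendsto (fun t => dF (S t) Sinf) atTop (nhds 0)) :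
    ∃ Q : Matrix (Fin d) (Fin d) ℝ, IsOrth Q ∧ ∀ i, frob (blk Sinf i - Q) ≤ 400 * τ := by
  have hτ := hR.τ_pos
  have hn := hR.one_le_sqrt_n
  obtain ⟨P, hP, hPT⟩ := (oracle_consistent hR hN hL n (by omega)).1
  have hPZ := frob_sub_ZStack_mul_le (by positivity) hPT
  set T := oracleSeq (dataMat A σ W) n with hTdef
  have hinit' : frob (S 0 - T * (Pᵀ * Q₀)) ≤ 1000 * τ * √(n : ℝ) := by
    have e : S 0 - T * (Pᵀ * Q₀) =
        (S 0 - ZStack n d * Q₀) - (T - ZStack n d * P) * (Pᵀ * Q₀) := by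
      rw [Matrix.sub_mul, Matrix.mul_assoc (ZStack n d) P, ← Matrix.mul_assoc P, hP.2,
        Matrix.one_mul]
      abel
    have := frob_sub_le (S 0 - ZStack n d * Q₀) ((T - ZStack n d * P) * (Pᵀ * Q₀))
    rw [frob_mul_orth (hP.transpose.mul hQ₀)] at this
    rw [e]
    linarith
  have hmain := gpm_near_oracle hR hN hL hS₀ hS (δ := 1000 * τ * √(n : ℝ))
    (by nlinarith [hR.small, mul_le_mul_of_nonneg_right hR.small (Real.sqrt_nonneg (n : ℝ))])
    (hP.transpose.mul hQ₀) hinit'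
  have hpow : Tendsto (fun t : ℕ => 1000 * τ * √(n : ℝ) / 2 ^ t) atTop (nhds 0) := by
    have := (tendsto_pow_atTop_nhds_zero_of_lt_one (r := (1 / 2 : ℝ)) (by norm_num)
      (by norm_num)).const_mul (1000 * τ * √(n : ℝ))
    simpa [div_eq_mul_inv] using this
  obtain ⟨t, ht₁, ht₂⟩ := ((hlim.eventually_lt_const hτ).and (hpow.eventually_lt_const hτ)).exists
  have hne : {r : ℝ | ∃ Q : Matrix (Fin d) (Fin d) ℝ, IsOrth Q ∧
      r = frob (S t - Sinf * Q)}.Nonempty := ⟨_, 1, IsOrth.one, rfl⟩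
  obtain ⟨_, ⟨R, hQR, rfl⟩, hRt⟩ := exists_lt_of_csInf_lt hne ht₁
  obtain ⟨Q, hQ, hQt⟩ := hmain t
  refine ⟨P * (Q * Rᵀ), hP.mul (hQ.mul hQR.transpose), fun i => ?_⟩
  have hclose : frob (Sinf - T * (Q * Rᵀ)) ≤ 202 * τ := by
    have e : (Sinf - T * (Q * Rᵀ)) * R = (S t - T * Q) - (S t - Sinf * R) := by
      rw [Matrix.sub_mul, Matrix.mul_assoc T, Matrix.mul_assoc Q, hQR.1, Matrix.mul_one]
      abel
    rw [← frob_mul_orth hQR, e]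
    have := frob_sub_le (S t - T * Q) (S t - Sinf * R)
    linarith
  have e : blk Sinf i - P * (Q * Rᵀ) =
      blk (Sinf - T * (Q * Rᵀ)) i + (blk T i - P) * (Q * Rᵀ) := by
    rw [blk_sub, blk_mul, Matrix.sub_mul]; abel
  have h1 := frob_blk_le (Sinf - T * (Q * Rᵀ)) i
  have h2 := frob_add_le (blk (Sinf - T * (Q * Rᵀ)) i) ((blk T i - P) * (Q * Rᵀ))
  rw [frob_mul_orth (hQ.mul hQR.transpose)] at h2
  rw [e]
  linarith [hPT i]

end Induction

section Spectral

variable {n d m k : ℕ} {A : Matrix (Fin d) (Fin m) ℝ} {W : Matrix (Fin n × Fin d) (Fin m) ℝ}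
  {s a κ σ B τ : ℝ}

/-- For a symmetric contraction `0 ≤ H ≤ 1`, `tr H² ≤ tr H`. -/
lemma frob_sq_le_trace {H : Matrix (Fin d) (Fin d) ℝ} (hsym : Hᵀ = H)
    (h₀ : ∀ v, 0 ≤ v ⬝ᵥ (H *ᵥ v)) (h₁ : OpLe H 1) : frob H ^ 2 ≤ trace H := by
  have hle : ∀ v, 0 * vnorm v ^ 2 ≤ v ⬝ᵥ ((1 - H) *ᵥ v) := fun v => by
    rw [sub_mulVec, one_mulVec, dotProduct_sub, ← vnorm_sq_dot]
    have h2 := dot_le_vnorm v (H *ᵥ v)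
    have h3 := mul_le_mul_of_nonneg_left (h₁.2 v) (vnorm_nonneg v)
    nlinarith
  have t1 := trace_conj_ge (F := H) hle
  have t2 := trace_conj_ge (F := 1 - H) (H := H) (s := 0) (fun v => by simpa using h₀ v)
  rw [zero_mul, hsym] at t1
  rw [zero_mul, transpose_sub, transpose_one, hsym] at t2
  have e : H * (1 - H) * H + (1 - H) * H * (1 - H) = H - H * H := by noncomm_ring
  have h4 : 0 ≤ trace (H - H * H) := by rw [← e, trace_add]; linarith
  rw [frob_sq_eq_trace, hsym]
  rw [trace_sub] at h4
  linarith

/-- A Davis–Kahan type bound: the overlap defect of two orthonormal frames. -/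
lemma exists_frob_sub_sq_le {N : Type*} [Fintype N] {U V : Matrix N (Fin d) ℝ}
    (hU : Uᵀ * U = 1) (hV : Vᵀ * V = 1) :
    ∃ Q : Matrix (Fin d) (Fin d) ℝ, IsOrth Q ∧
      frob (U - V * Q) ^ 2 ≤ 2 * (d - frob (Vᵀ * U) ^ 2) := by
  obtain ⟨Q, hQ⟩ := exists_isPolar (Vᵀ * U)
  refine ⟨Q, hQ.1, ?_⟩
  have hOp : OpLe (Qᵀ * (Vᵀ * U)) 1 := by
    have := (opLe_of_transpose_mul (Q := Qᵀ) (by simpa using hQ.1.2)).mul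
      ((opLe_of_transpose_mul hV).transpose.mul (opLe_of_transpose_mul hU))
    simpa using this
  have h1 := frob_sq_le_trace hQ.symm hQ.nonneg hOp
  rw [frob_mul_of_transpose_mul (Q := Qᵀ) (by simpa using hQ.1.2)] at h1
  have hfU : frob U ^ 2 = d := by rw [frob_sq_eq_trace, hU]; simp
  have hfV : frob (V * Q) ^ 2 = d := by rw [frob_mul_orth hQ.1, frob_sq_eq_trace, hV]; simp
  rw [frob_sub_sq, hfU, hfV, trace_transpose_mul_comm, transpose_mul, Matrix.mul_assoc]
  linarith

/-- Orthonormal frames with almost maximal Gram trace are close to the signal subspace. -/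
lemma exists_spectral_close {N : Type*} [Fintype N] {C : Matrix N N ℝ} {U V : Matrix N (Fin d) ℝ}
    (hU : Uᵀ * U = 1) (hV : Vᵀ * V = 1) (hs : 0 < s)
    (hA : ∀ u, s * vnorm u ≤ vnorm (Aᵀ *ᵥ u)) {c ρ : ℝ} (hc : 0 < c)
    (hmax : ∀ Q : Matrix N (Fin d) ℝ, Qᵀ * Q = 1 → trace (Qᵀ * C * Q) ≤ trace (Uᵀ * C * U))
    (hρ : ∀ X : Matrix N (Fin d) ℝ,
      frob (C * X - c • (V * (A * Aᵀ) * (Vᵀ * X))) ≤ ρ * frob X) :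
    ∃ Q : Matrix (Fin d) (Fin d) ℝ, IsOrth Q ∧
      c * s ^ 2 * frob (U - V * Q) ≤ 4 * ρ * √(d : ℝ) := by
  obtain ⟨Q, hQ, hy⟩ := exists_frob_sub_sq_le hU hV
  refine ⟨Q, hQ, ?_⟩
  set G := A * Aᵀ with hG
  set M := Vᵀ * U with hM
  have hVQ : (V * Q)ᵀ * (V * Q) = 1 := by
    rw [transpose_mul, Matrix.mul_assoc, ← Matrix.mul_assoc Vᵀ, hV, Matrix.one_mul, hQ.1]
  have hfU : frob U = √(d : ℝ) := by
    rw [← Real.sqrt_sq (frob_nonneg U), frob_sq_eq_trace, hU]; simp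
  have hfV : frob (V * Q) = √(d : ℝ) := by
    rw [← Real.sqrt_sq (frob_nonneg (V * Q)), frob_sq_eq_trace, hVQ]; simp
  have hgram : ∀ v, s ^ 2 * vnorm v ^ 2 ≤ v ⬝ᵥ (G *ᵥ v) := fun v => by
    have h1 := vnorm_mulVec_sq Aᵀ v
    rw [transpose_transpose] at h1
    rw [← h1, ← mul_pow]
    exact pow_le_pow_left₀ (mul_nonneg hs.le (vnorm_nonneg v)) (hA v) 2
  have hF : (V - U * Mᵀ)ᵀ * (V - U * Mᵀ) = 1 - M * Mᵀ := by
    have e1 : Uᵀ * V = Mᵀ := by rw [hM, transpose_mul, transpose_transpose]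
    have e2 : M * (Uᵀ * (U * Mᵀ)) = M * Mᵀ := by
      rw [← Matrix.mul_assoc Uᵀ, hU, Matrix.one_mul]
    have e3 : Vᵀ * (U * Mᵀ) = M * Mᵀ := by rw [← Matrix.mul_assoc]
    simp only [transpose_sub, transpose_mul, transpose_transpose, Matrix.sub_mul, Matrix.mul_sub,
      Matrix.mul_assoc, hV, e1, e2, e3]
    abel
  have hlow : s ^ 2 * (d - frob M ^ 2) ≤ trace G - trace (Mᵀ * G * M) := by
    have h1 := trace_conj_ge (F := V - U * Mᵀ) hgram
    have e1 : trace ((V - U * Mᵀ) * G * (V - U * Mᵀ)ᵀ) = trace G - trace (Mᵀ * G * M) := by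
      rw [trace_mul_comm, ← Matrix.mul_assoc, hF, Matrix.sub_mul, Matrix.one_mul, trace_sub,
        Matrix.mul_assoc M, trace_mul_comm M (Mᵀ * G)]
    have e2 : frob (V - U * Mᵀ) ^ 2 = d - frob M ^ 2 := by
      rw [frob_sq_eq_trace, hF, trace_sub, trace_mul_comm M Mᵀ, ← frob_sq_eq_trace, trace_one,
        Fintype.card_fin]
    rwa [e1, e2] at h1
  set R : Matrix N (Fin d) ℝ → Matrix N (Fin d) ℝ := fun X => C * X - c • (V * G * (Vᵀ * X))
    with hRdef
  have htr : ∀ X Y : Matrix N (Fin d) ℝ, trace (Xᵀ * C * Y) =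
      c * trace ((Vᵀ * X)ᵀ * G * (Vᵀ * Y)) + trace (Xᵀ * R Y) := fun X Y => by
    rw [hRdef]
    simp only [Matrix.mul_sub, trace_sub, Matrix.mul_smul, trace_smul, smul_eq_mul, transpose_mul,
      transpose_transpose, Matrix.mul_assoc]
    ring
  have h1 := hmax (V * Q) hVQ
  have h2 : trace (Uᵀ * R U) - trace ((V * Q)ᵀ * R (V * Q)) ≤
      2 * (ρ * √(d : ℝ) * frob (U - V * Q)) := by
    have e : trace (Uᵀ * R U) - trace ((V * Q)ᵀ * R (V * Q)) =
        trace ((U - V * Q)ᵀ * R U) + trace ((V * Q)ᵀ * R (U - V * Q)) := by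
      have e1 : R (U - V * Q) = R U - R (V * Q) := by
        simp only [hRdef, Matrix.mul_sub, smul_sub]; abel
      rw [e1, transpose_sub, Matrix.sub_mul, Matrix.mul_sub (V * Q)ᵀ (R U) (R (V * Q)), trace_sub,
        trace_sub]
      ring
    rw [e]
    have p1 := trace_le_frob (U - V * Q) (R U)
    have p2 := trace_le_frob (V * Q) (R (U - V * Q))
    have p3 := mul_le_mul_of_nonneg_left (hρ U) (frob_nonneg (U - V * Q))
    have p4 := mul_le_mul_of_nonneg_left (hρ (U - V * Q)) (frob_nonneg (V * Q))
    rw [hfU] at p3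
    rw [hfV] at p2 p4
    linarith
  have h3 : trace ((Vᵀ * (V * Q))ᵀ * G * (Vᵀ * (V * Q))) = trace G := by
    rw [← Matrix.mul_assoc Vᵀ V, hV, Matrix.one_mul, trace_mul_comm, ← Matrix.mul_assoc, hQ.2,
      Matrix.one_mul]
  rw [htr, htr, h3] at h1
  have h4 : c * (s ^ 2 * (d - frob M ^ 2)) ≤ 2 * (ρ * √(d : ℝ) * frob (U - V * Q)) := by
    have := mul_le_mul_of_nonneg_left hlow hc.le
    linarith
  have h5 : c * s ^ 2 * frob (U - V * Q) ^ 2 ≤ c * s ^ 2 * (2 * (d - frob M ^ 2)) :=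
    mul_le_mul_of_nonneg_left hy (by positivity)
  rcases (frob_nonneg (U - V * Q)).eq_or_lt with h0 | h0
  · have h6 := (frob_nonneg _).trans (hρ U)
    rw [hfU] at h6
    rw [← h0]
    linarith
  · refine le_of_mul_le_mul_right ?_ h0
    linarith

lemma spectral_init (hR : Regime n d s a κ σ B τ) (hN : NoiseBound A W s a B)
    {U S : Matrix (Fin n × Fin d) (Fin d) ℝ} (hU : IsTopSingVecs (dataMat A σ W) U)
    (hS : IsPolarBlocks U S) :
    ∃ Q : Matrix (Fin d) (Fin d) ℝ, IsOrth Q ∧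
      frob (S - ZStack n d * Q) ≤ 900 * τ * √(n : ℝ) := by
  have hn := hR.one_le_sqrt_n
  have hn0 : 0 < √(n : ℝ) := by linarith
  have hn2 : √(n : ℝ) * √(n : ℝ) = n := Real.mul_self_sqrt (Nat.cast_nonneg n)
  have hnp : (0 : ℝ) < n := by linarith [hR.one_le_n]
  have hi : (√(n : ℝ))⁻¹ * (√(n : ℝ))⁻¹ = (n : ℝ)⁻¹ := by rw [← mul_inv, hn2]
  set V : Matrix (Fin n × Fin d) (Fin d) ℝ := (√(n : ℝ))⁻¹ • ZStack n d with hVdef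
  have hV : Vᵀ * V = 1 := by
    rw [hVdef, transpose_smul, Matrix.smul_mul, Matrix.mul_smul, smul_smul,
      orthBlocks_ZStack.transpose_mul_self, smul_smul, hi, inv_mul_cancel₀ hnp.ne', one_smul]
  have hρ : ∀ X : Matrix (Fin n × Fin d) (Fin d) ℝ,
      frob (dataMat A σ W * (dataMat A σ W)ᵀ * X - (n : ℝ) • (V * (A * Aᵀ) * (Vᵀ * X))) ≤
        (2 * σ * √(n : ℝ) * a * (8 * B) + σ ^ 2 * (8 * B) ^ 2) * frob X := fun X => by
    have e : (n : ℝ) • (V * (A * Aᵀ) * (Vᵀ * X)) =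
        ZStack n d * A * Aᵀ * (ZStack n d)ᵀ * X := by
      rw [hVdef, transpose_smul]
      simp only [Matrix.smul_mul, Matrix.mul_smul, smul_smul, Matrix.mul_assoc]
      rw [hi, mul_inv_cancel₀ hnp.ne', one_smul]
    rw [e]
    exact frob_noise_mul_le hR.σ_pos.le hN.upper hN.noise X
  obtain ⟨Q, hQ, hclose⟩ := exists_spectral_close hU.1 hV hR.s_pos hN.lower hnp hU.2 hρ
  refine ⟨Q, hQ, ?_⟩
  have hgap := hR.gap_pos
  have hy : frob (U - V * Q) ≤ 65 * τ := by
    refine le_of_mul_le_mul_left (hclose.trans ?_) hgap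
    have h1 := hR.cross
    have h2 := hR.quad
    have h3 := mul_pos hR.τ_pos hgap
    linarith
  have hlow : ∀ i v, (√(n : ℝ))⁻¹ * vnorm v ≤ vnorm (blk (V * Q) i *ᵥ v) := fun i v => by
    rw [blk_mul, hVdef, blk_smul, blk_ZStack, Matrix.smul_mul, Matrix.one_mul, smul_mulVec,
      vnorm_smul, vnorm_mulVec_of_transpose_mul hQ.1, abs_of_pos (inv_pos.2 hn0)]
  have hpol : IsPolarBlocks (V * Q) (ZStack n d * Q) := by
    refine IsPolarBlocks.mul_right (fun i => ?_) hQ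
    have h1 := (isPolar_gram (1 : Matrix (Fin d) (Fin d) ℝ)).smul (inv_nonneg.2 hn0.le)
    rw [transpose_one, Matrix.one_mul] at h1
    rwa [hVdef, blk_smul, blk_ZStack]
  have h1 := hS.dist_le hpol (inv_pos.2 hn0) hlow
  rw [div_inv_eq_mul] at h1
  have h2 := mul_le_mul_of_nonneg_left hy hn0.le
  nlinarith [mul_pos hR.τ_pos hn0]

end Spectral

section Nets

variable {α β : Type*} [Fintype α] [Fintype β]

/-- A `1/2`-net of the Euclidean unit ball. -/
def IsHalfNet (N : Finset (β → ℝ)) : Prop :=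
  (∀ u ∈ N, vnorm u ≤ 1) ∧ ∀ v, vnorm v ≤ 1 → ∃ u ∈ N, vnorm (v - u) ≤ 1 / 2

/-- The unit ball has a `1/2`-net with at most `5 ^ dim` points. -/
lemma exists_isHalfNet (β : Type*) [Fintype β] :
    ∃ N : Finset (β → ℝ), N.card ≤ 5 ^ Fintype.card β ∧ IsHalfNet N := by
  classical
  let E := EuclideanSpace ℝ β
  let good : Finset E → Prop := fun s =>
    (∀ c ∈ s, ‖c‖ ≤ 2) ∧ ∀ c ∈ s, ∀ e ∈ s, c ≠ e → 1 ≤ ‖c - e‖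
  have hcard : ∀ s, good s → s.card ≤ 5 ^ Fintype.card β := fun s hs => by
    simpa [E] using Besicovitch.card_le_of_separated s hs.1 hs.2
  obtain ⟨s, hs, hmax⟩ : ∃ s, good s ∧ ∀ r, good r → r.card ≤ s.card := by
    let P : ℕ → Prop := fun k => ∃ s, good s ∧ s.card = k
    have hP : P 0 := ⟨∅, ⟨by simp, by simp⟩, rfl⟩
    obtain ⟨s, hs, hsk⟩ := Nat.findGreatest_spec (P := P) (Nat.zero_le (5 ^ Fintype.card β)) hP
    exact ⟨s, hs, fun r hr => hsk ▸ Nat.le_findGreatest (hcard r hr) ⟨r, hr, rfl⟩⟩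
  refine ⟨s.image fun c => (2⁻¹ : ℝ) • WithLp.ofLp c, Finset.card_image_le.trans (hcard s hs),
    fun u hu => ?_, fun v hv => ?_⟩
  · obtain ⟨c, hc, rfl⟩ := Finset.mem_image.1 hu
    have := hs.1 c hc
    rw [vnorm_smul, vnorm_eq, WithLp.toLp_ofLp, abs_of_pos (by norm_num)]
    linarith
  · set w : E := (2 : ℝ) • WithLp.toLp 2 v with hw
    have hwn : ‖w‖ ≤ 2 := by
      rw [hw, norm_smul, ← vnorm_eq, Real.norm_of_nonneg (by norm_num)]; linarith
    obtain ⟨c, hc, hcw⟩ : ∃ c ∈ s, ‖w - c‖ ≤ 1 := by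
      by_contra! hcon
      have hnot : w ∉ s := fun h => by simpa using (hcon w h).trans_le' zero_le_one
      have : good (insert w s) := by
        refine ⟨fun c hc => ?_, fun c hc e he hce => ?_⟩
        · rcases Finset.mem_insert.1 hc with rfl | hc
          exacts [hwn, hs.1 c hc]
        · rcases Finset.mem_insert.1 hc with rfl | hc <;>
            rcases Finset.mem_insert.1 he with rfl | he
          · exact absurd rfl hce
          · exact (hcon e he).le
          · rw [norm_sub_rev]; exact (hcon c hc).le
          · exact hs.2 c hc e he hce
      have := hmax _ this
      rw [Finset.card_insert_of_notMem hnot] at this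
      omega
    refine ⟨_, Finset.mem_image_of_mem _ hc, ?_⟩
    have e : v - (2⁻¹ : ℝ) • WithLp.ofLp c = (2⁻¹ : ℝ) • WithLp.ofLp (w - c) := by
      change v - (2⁻¹ : ℝ) • WithLp.ofLp c = (2⁻¹ : ℝ) • ((2 : ℝ) • v - WithLp.ofLp c)
      rw [smul_sub, smul_smul, inv_mul_cancel₀ two_ne_zero, one_smul]
    rw [e, vnorm_smul, vnorm_eq, WithLp.toLp_ofLp, abs_of_pos (by norm_num)]
    linarith

lemma IsHalfNet.vnorm_le {N : Finset (β → ℝ)} (hN : IsHalfNet N) {w : β → ℝ} {t : ℝ}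
    (h : ∀ u ∈ N, u ⬝ᵥ w ≤ t) : vnorm w ≤ 2 * t := by
  rcases (vnorm_nonneg w).eq_or_lt with h0 | h0
  · obtain ⟨u, hu, -⟩ := hN.2 0 (by rw [vnorm_zero]; exact zero_le_one)
    have := h u hu
    rw [vnorm_eq_zero h0.symm, dotProduct_zero] at this
    rw [← h0]; linarith
  · obtain ⟨u, hu, hd⟩ := hN.2 ((vnorm w)⁻¹ • w) (by
      rw [vnorm_smul, abs_of_pos (inv_pos.2 h0), inv_mul_cancel₀ h0.ne'])
    have h1 := h u hu
    have h2 := dot_le_vnorm ((vnorm w)⁻¹ • w - u) w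
    have h3 := mul_le_mul_of_nonneg_right hd h0.le
    rw [sub_dotProduct, smul_dotProduct, ← vnorm_sq_dot, smul_eq_mul, sq,
      inv_mul_cancel_left₀ h0.ne'] at h2
    linarith

lemma IsHalfNet.opLe {N : Finset (β → ℝ)} (hN : IsHalfNet N) {X : Matrix α β ℝ} {t : ℝ}
    (h : ∀ v ∈ N, vnorm (X *ᵥ v) ≤ t) : OpLe X (2 * t) := by
  have ht : 0 ≤ t := by
    obtain ⟨u, hu, -⟩ := hN.2 0 (by rw [vnorm_zero]; exact zero_le_one)
    exact (vnorm_nonneg _).trans (h u hu)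
  refine (opLe_opNorm X).mono ?_
  have key : opNorm X ≤ t + opNorm X / 2 := by
    refine Real.sSup_le ?_ (by linarith [(opLe_opNorm X).1])
    rintro r ⟨v, hv, rfl⟩
    obtain ⟨u, hu, hd⟩ := hN.2 v hv.le
    have h1 := (opLe_opNorm X).2 (v - u)
    have h2 := mul_le_mul_of_nonneg_left hd (opLe_opNorm X).1
    have h3 := vnorm_add_le (X *ᵥ u) (X *ᵥ (v - u))
    rw [← mulVec_add, add_sub_cancel] at h3
    linarith [h u hu]
  linarith

/-- A bilinear bound on nets yields an operator norm bound. -/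
lemma opLe_mul_of_nets {γ : Type*} [Fintype γ] {N : Finset (α → ℝ)} {N' : Finset (β → ℝ)}
    (hN : IsHalfNet N) (hN' : IsHalfNet N') {G : Matrix α γ ℝ} {M : Matrix γ β ℝ} {L t : ℝ}
    (ht : 0 ≤ t) (hM : OpLe M L)
    (h : ∀ u ∈ N, ∀ v ∈ N', u ⬝ᵥ (G *ᵥ (M *ᵥ v)) ≤ t * vnorm (M *ᵥ v)) :
    OpLe (G * M) (4 * (L * t)) := by
  have h1 := hN'.opLe (X := G * M) (t := 2 * (t * L)) fun v hv => by
    refine hN.vnorm_le fun u hu => ?_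
    rw [← mulVec_mulVec]
    refine (h u hu v hv).trans (mul_le_mul_of_nonneg_left ?_ ht)
    have := mul_le_mul_of_nonneg_left (hN'.1 v hv) hM.1
    linarith [hM.2 v]
  exact h1.mono (by linarith)

end Nets

section GaussianTail

open ProbabilityTheory

variable {ι κ : Type*} [Fintype ι] [Fintype κ]

instance : IsProbabilityMeasure (stdGaussian ι κ) := by
  unfold stdGaussian; infer_instance

lemma hasSubgaussianMGF_gaussianReal : HasSubgaussianMGF id 1 (gaussianReal 0 1) where
  integrable_exp_mul t := integrable_exp_mul_gaussianReal t
  mgf_le t := by rw [mgf_id_gaussianReal]; simp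

/-- Weighted sums of independent sub-Gaussian coordinates are sub-Gaussian. -/
lemma hasSubgaussianMGF_pi_sum {E : ι → Type*} [∀ i, MeasurableSpace (E i)]
    {μ : ∀ i, Measure (E i)} [∀ i, IsProbabilityMeasure (μ i)] {X : ∀ i, E i → ℝ} {c : NNReal}
    (hX : ∀ i, HasSubgaussianMGF (X i) c (μ i)) (u : ι → ℝ) :
    HasSubgaussianMGF (fun w : ∀ i, E i => ∑ i, u i * X i (w i)) (∑ i, Real.toNNReal (u i ^ 2) * c)
      (Measure.pi μ) := by
  refine HasSubgaussianMGF.sum_of_iIndepFun (X := fun i (w : ∀ i, E i) => u i * X i (w i))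
    ?_ fun i _ => ?_
  · exact iIndepFun_pi (X := fun i x => u i * X i x) fun i => (hX i).aemeasurable.const_mul _
  · have h1 := (hX i).const_mul (u i)
    have h2 : (⟨u i ^ 2, sq_nonneg _⟩ : NNReal) = Real.toNNReal (u i ^ 2) := by
      ext; simp [sq_nonneg]
    rw [h2] at h1
    have h3 : (Measure.pi μ).map (fun w => w i) = μ i := (measurePreserving_eval μ i).map_eq
    rw [← h3] at h1
    exact HasSubgaussianMGF.of_map (Y := fun w : ∀ i, E i => w i)
      (measurable_pi_apply i).aemeasurable h1

lemma sum_toNNReal_sq (v : ι → ℝ) : ∑ j, Real.toNNReal (v j ^ 2) = Real.toNNReal (vnorm v ^ 2) := by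
  rw [vnorm_sq, Real.toNNReal_sum_of_nonneg fun _ _ => sq_nonneg _]

lemma hasSubgaussianMGF_bilin (u : ι → ℝ) (v : κ → ℝ) :
    HasSubgaussianMGF (fun W => u ⬝ᵥ (Matrix.of W *ᵥ v)) (Real.toNNReal (vnorm u ^ 2 * vnorm v ^ 2))
      (stdGaussian ι κ) := by
  have h1 := hasSubgaussianMGF_pi_sum (μ := fun _ : κ => gaussianReal 0 1) (X := fun _ => id)
    (fun _ => hasSubgaussianMGF_gaussianReal) v
  have h2 := hasSubgaussianMGF_pi_sum (fun _ : ι => h1) u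
  simp only [mul_one, sum_toNNReal_sq] at h2
  rw [← Finset.sum_mul, sum_toNNReal_sq, ← Real.toNNReal_mul (sq_nonneg _)] at h2
  have e : (fun W : ι → κ → ℝ => u ⬝ᵥ (Matrix.of W *ᵥ v)) =
      fun W => ∑ i, u i * ∑ j, v j * id (W i j) := by
    ext W
    simp [mulVec, dotProduct, mul_comm]
  rw [e]
  exact h2

/-- Gaussian tail of a bilinear form. -/
lemma stdGaussian_bilin_tail {u : ι → ℝ} (hu : vnorm u ≤ 1) (v : κ → ℝ) {t : ℝ} (ht : 0 ≤ t) :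
    stdGaussian ι κ {W | t * vnorm v < u ⬝ᵥ (Matrix.of W *ᵥ v)} ≤
      ENNReal.ofReal (Real.exp (-t ^ 2 / 2)) := by
  rcases (vnorm_nonneg v).eq_or_lt with h0 | h0
  · have hv := vnorm_eq_zero h0.symm
    simp [hv, vnorm_zero]
  · have h1 := hasSubgaussianMGF_bilin u v
    have h2 : HasSubgaussianMGF (fun W => u ⬝ᵥ (Matrix.of W *ᵥ v))
        (Real.toNNReal (vnorm v ^ 2)) (stdGaussian ι κ) := by
      refine ⟨h1.integrable_exp_mul, fun r => (h1.mgf_le r).trans (Real.exp_le_exp.2 ?_)⟩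
      gcongr
      have := pow_le_one₀ (n := 2) (vnorm_nonneg u) hu
      nlinarith [sq_nonneg (vnorm v)]
    have h3 := h2.measure_ge_le (ε := t * vnorm v) (by positivity)
    rw [Real.coe_toNNReal _ (sq_nonneg _)] at h3
    have h4 : -(t * vnorm v) ^ 2 / (2 * vnorm v ^ 2) = -t ^ 2 / 2 := by field_simp
    rw [h4] at h3
    refine (measure_mono fun W hW => ?_).trans
      ((ENNReal.le_ofReal_iff_toReal_le (measure_ne_top _ _) (Real.exp_pos _).le).2 h3)
    exact le_of_lt (Set.mem_ofPred.1 hW)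

/-- Conditional Gaussian tail: the direction may depend on the rows not involved in `u`. -/
lemma stdGaussian_bilin_tail_of_dependsOn (p : ι → Prop) [DecidablePred p] {u : ι → ℝ}
    (hu : vnorm u ≤ 1) (hup : ∀ x, ¬ p x → u x = 0) {w : (ι → κ → ℝ) → κ → ℝ} (hw : Measurable w)
    (hdep : ∀ W W', (∀ x, ¬ p x → W x = W' x) → w W = w W') {t : ℝ} (ht : 0 ≤ t) :
    stdGaussian ι κ {W | t * vnorm (w W) < u ⬝ᵥ (Matrix.of W *ᵥ w W)} ≤
      ENNReal.ofReal (Real.exp (-t ^ 2 / 2)) := by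
  let ext : ({x // ¬ p x} → κ → ℝ) → ι → κ → ℝ := fun b x => if h : p x then 0 else b ⟨x, h⟩
  have hext : Measurable ext := by
    refine measurable_pi_lambda _ fun x => ?_
    by_cases h : p x
    · simp only [ext, h, dite_true]; exact measurable_const
    · simp only [ext, h, dite_false]; exact measurable_pi_apply _
  let u' : {x // p x} → ℝ := fun x => u x
  have hsub : ∀ f : ι → ℝ, (∀ x, ¬ p x → f x = 0) → ∑ x, f x = ∑ x : {x // p x}, f x := by
    intro f hf
    rw [← Finset.sum_subtype (Finset.univ.filter p) (by simp) f]
    exact (Finset.sum_filter_of_ne fun x _ hx => by_contra fun h => hx (hf x h)).symm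
  have hu' : vnorm u' ≤ 1 := by
    refine (le_of_eq ?_).trans hu
    unfold vnorm
    rw [hsub (fun x => u x ^ 2) fun x hx => by simp [hup x hx]]
  let T : Set (({x // p x} → κ → ℝ) × ({x // ¬ p x} → κ → ℝ)) :=
    {q | t * vnorm (w (ext q.2)) < u' ⬝ᵥ (Matrix.of q.1 *ᵥ w (ext q.2))}
  have hw' : Measurable fun q : ({x // p x} → κ → ℝ) × ({x // ¬ p x} → κ → ℝ) => w (ext q.2) :=
    hw.comp (hext.comp measurable_snd)
  have hT : MeasurableSet T := by
    refine measurableSet_lt ((vnorm_continuous.measurable.comp hw').const_mul t) ?_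
    unfold dotProduct mulVec dotProduct
    refine Finset.measurable_fun_sum _ fun x _ => Measurable.const_mul ?_ _
    refine Finset.measurable_fun_sum _ fun j _ => Measurable.mul ?_ ?_
    · exact (measurable_pi_apply j).comp ((measurable_pi_apply x).comp measurable_fst)
    · exact (measurable_pi_apply j).comp hw'
  have hmp := measurePreserving_piEquivPiSubtypeProd
    (fun _ : ι => Measure.pi fun _ : κ => gaussianReal 0 1) p
  have hpre : {W : ι → κ → ℝ | t * vnorm (w W) < u ⬝ᵥ (Matrix.of W *ᵥ w W)} =
      MeasurableEquiv.piEquivPiSubtypeProd (fun _ => κ → ℝ) p ⁻¹' T := by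
    ext W
    have e1 : w (ext fun x : {x // ¬ p x} => W x) = w W :=
      hdep _ _ fun x hx => by simp only [ext, hx, dite_false]
    change _ ↔ t * vnorm (w (ext fun x : {x // ¬ p x} => W x)) <
      u' ⬝ᵥ (Matrix.of (fun x : {x // p x} => W x) *ᵥ w (ext fun x : {x // ¬ p x} => W x))
    rw [e1]
    have e2 : u ⬝ᵥ (Matrix.of W *ᵥ w W) =
        u' ⬝ᵥ (Matrix.of (fun x : {x // p x} => W x) *ᵥ w W) :=
      hsub (fun x => u x * (Matrix.of W *ᵥ w W) x) fun x hx => by simp [hup x hx]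
    rw [Set.mem_ofPred_eq, e2]
  rw [hpre]
  unfold stdGaussian
  rw [hmp.measure_preimage_equiv, Measure.prod_apply_symm hT]
  refine (lintegral_mono fun b => stdGaussian_bilin_tail hu' (w (ext b)) ht).trans ?_
  simp

/-- Union bound over nets. -/
lemma measure_not_opLe_le {Ω : Type*} [MeasurableSpace Ω] {μ : Measure Ω} {α β γ : Type*}
    [Fintype α] [Fintype β] [Fintype γ] {G : Ω → Matrix α γ ℝ} {M : Ω → Matrix γ β ℝ} {t : ℝ}
    (ht : 0 ≤ t) (h : ∀ u, vnorm u ≤ 1 → ∀ v,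
      μ {ω | t * vnorm (M ω *ᵥ v) < u ⬝ᵥ (G ω *ᵥ (M ω *ᵥ v))} ≤
        ENNReal.ofReal (Real.exp (-t ^ 2 / 2))) :
    μ {ω | ∃ L, OpLe (M ω) L ∧ ¬ OpLe (G ω * M ω) (4 * (L * t))} ≤
      ENNReal.ofReal (5 ^ (Fintype.card α + Fintype.card β) * Real.exp (-t ^ 2 / 2)) := by
  obtain ⟨N, hNc, hN⟩ := exists_isHalfNet α
  obtain ⟨N', hNc', hN'⟩ := exists_isHalfNet β
  have hsub : {ω | ∃ L, OpLe (M ω) L ∧ ¬ OpLe (G ω * M ω) (4 * (L * t))} ⊆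
      ⋃ q ∈ N ×ˢ N', {ω | t * vnorm (M ω *ᵥ q.2) < q.1 ⬝ᵥ (G ω *ᵥ (M ω *ᵥ q.2))} := by
    rintro ω ⟨L, hL, hnot⟩
    by_contra hcon
    simp only [Set.mem_iUnion, not_exists, Set.mem_ofPred_eq, not_lt] at hcon
    exact hnot (opLe_mul_of_nets hN hN' ht hL fun u hu v hv =>
      hcon (u, v) (Finset.mem_product.2 ⟨hu, hv⟩))
  refine (measure_mono hsub).trans ((measure_biUnion_finset_le _ _).trans ?_)
  refine (Finset.sum_le_sum fun q hq => h q.1 (hN.1 _ (Finset.mem_product.1 hq).1) q.2).trans ?_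
  rw [Finset.sum_const, Finset.card_product, nsmul_eq_mul, ENNReal.ofReal_mul (by positivity)]
  gcongr
  rw [pow_add, ← ENNReal.ofReal_natCast]
  refine ENNReal.ofReal_le_ofReal ?_
  push_cast
  have h1 : (N.card : ℝ) ≤ 5 ^ Fintype.card α := by exact_mod_cast hNc
  have h2 : (N'.card : ℝ) ≤ 5 ^ Fintype.card β := by exact_mod_cast hNc'
  gcongr

end GaussianTail

section Measurability

variable {n d m : ℕ}

lemma exists_lower_of_det_ne_zero {X : Matrix (Fin d) (Fin d) ℝ} (h : X.det ≠ 0) :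
    ∃ s, 0 < s ∧ ∀ v, s * vnorm v ≤ vnorm (X *ᵥ v) := by
  have hpos : 0 < frob X⁻¹ + 1 := by linarith [frob_nonneg X⁻¹]
  refine ⟨(frob X⁻¹ + 1)⁻¹, inv_pos.2 hpos, fun v => ?_⟩
  have h1 := vnorm_mulVec_le_frob X⁻¹ (X *ᵥ v)
  rw [mulVec_mulVec, nonsing_inv_mul _ (isUnit_iff_ne_zero.2 h), one_mulVec] at h1
  rw [inv_mul_le_iff₀ hpos]
  linarith [vnorm_nonneg (X *ᵥ v)]

lemma continuousOn_polarSel_apply (a b : Fin d) :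
    ContinuousOn (fun X : Fin d → Fin d → ℝ => polarSel (Matrix.of X) a b)
      {X | (Matrix.of X).det ≠ 0} := by
  intro Y hY
  obtain ⟨s, hs, hlow⟩ := exists_lower_of_det_ne_zero hY
  refine tendsto_iff_dist_tendsto_zero.2 ?_
  refine squeeze_zero' (g := fun X : Fin d → Fin d → ℝ =>
    2 / s * frob (Matrix.of X - Matrix.of Y)) (Eventually.of_forall fun _ => dist_nonneg) ?_ ?_
  · filter_upwards [self_mem_nhdsWithin] with X hX
    exact (abs_entry_le_frob (polarSel (Matrix.of X) - polarSel (Matrix.of Y)) a b).trans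
      ((isPolar_polarSel hX).dist_le (isPolar_polarSel hY) hs hlow)
  · have hc : Continuous fun X : Fin d → Fin d → ℝ =>
        2 / s * frob (Matrix.of X - Matrix.of Y) :=
      continuous_const.mul (frob_continuous.comp (continuous_id.sub continuous_const))
    have := (hc.tendsto Y).mono_left (nhdsWithin_le_nhds (s := {X | (Matrix.of X).det ≠ 0}))
    simpa [frob_zero] using this

lemma measurable_polarSel_apply (a b : Fin d) :
    Measurable fun X : Fin d → Fin d → ℝ => polarSel (Matrix.of X) a b := by
  classical
  have hdet : Continuous fun X : Fin d → Fin d → ℝ => (Matrix.of X).det :=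
    Continuous.matrix_det (A := fun X : Fin d → Fin d → ℝ => Matrix.of X) continuous_id
  have hopen : IsOpen {X : Fin d → Fin d → ℝ | (Matrix.of X).det ≠ 0} :=
    isOpen_ne_fun hdet continuous_const
  have h := (continuousOn_polarSel_apply (d := d) a b).measurable_piecewise
    (continuousOn_const (c := (1 : Matrix (Fin d) (Fin d) ℝ) a b)) hopen.measurableSet
  convert h using 1
  ext X
  by_cases hX : (Matrix.of X).det = 0
  · rw [Set.piecewise_eq_of_notMem _ _ _ (by simpa using hX), polarSel, if_pos hX]
  · rw [Set.piecewise_eq_of_mem _ _ _ hX]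

variable {Ω : Type*} [MeasurableSpace Ω]

lemma measurable_mul_apply {α β δ : Type*} [Fintype β] {M : Ω → Matrix α β ℝ}
    {N : Ω → Matrix β δ ℝ} (hM : ∀ a b, Measurable fun ω => M ω a b)
    (hN : ∀ a b, Measurable fun ω => N ω a b) (a : α) (c : δ) :
    Measurable fun ω => (M ω * N ω) a c := by
  simp only [mul_apply]
  exact Finset.measurable_fun_sum _ fun j _ => (hM a j).mul (hN j c)

lemma measurable_oracleSeq_apply {D : Ω → Matrix (Fin n × Fin d) (Fin m) ℝ}
    (hD : ∀ a b, Measurable fun ω => D ω a b) (t : ℕ) :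
    ∀ p b, Measurable fun ω => oracleSeq (D ω) t p b := by
  induction t with
  | zero => exact fun p b => measurable_const
  | succ t ih =>
    intro p b
    have h := measurable_mul_apply (measurable_mul_apply hD (N := fun ω => (D ω)ᵀ)
      fun a b => hD b a) ih
    exact (measurable_polarSel_apply p.2 b).comp
      (measurable_pi_lambda _ fun a' => measurable_pi_lambda _ fun b' => h (p.1, a') b')

end Measurability

section Events

variable {n d m k : ℕ}

/-- Conditional tail for one block row of the noise. -/
lemma blk_bilin_tail (i : Fin n)
    {M : Matrix (Fin n × Fin d) (Fin m) ℝ → Matrix (Fin m) (Fin k) ℝ}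
    (hM : ∀ a b, Measurable fun W : Fin n × Fin d → Fin m → ℝ => M (mask (Matrix.of W) i) a b)
    {t : ℝ} (ht : 0 ≤ t) {u : Fin d → ℝ} (hu : vnorm u ≤ 1) (v : Fin k → ℝ) :
    stdGaussian (Fin n × Fin d) (Fin m) {W | t * vnorm (M (mask (Matrix.of W) i) *ᵥ v) <
        u ⬝ᵥ (blk (Matrix.of W) i *ᵥ (M (mask (Matrix.of W) i) *ᵥ v))} ≤
      ENNReal.ofReal (Real.exp (-t ^ 2 / 2)) := by
  let u' : Fin n × Fin d → ℝ := fun x => if x.1 = i then u x.2 else 0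
  have hu' : vnorm u' ≤ 1 := by
    refine (le_of_eq ?_).trans hu
    simp [vnorm, u', Fintype.sum_prod_type]
  have hw : Measurable fun W : Fin n × Fin d → Fin m → ℝ => M (mask (Matrix.of W) i) *ᵥ v := by
    refine measurable_pi_lambda _ fun a => ?_
    simp only [mulVec, dotProduct]
    exact Finset.measurable_fun_sum _ fun j _ => (hM a j).mul_const _
  have h := stdGaussian_bilin_tail_of_dependsOn (fun x : Fin n × Fin d => x.1 = i) hu'
    (fun x hx => if_neg hx) hw (fun W W' hWW => by
      have : mask (Matrix.of W) i = mask (Matrix.of W') i := by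
        ext p b
        by_cases hp : p.1 = i
        · simp [mask, hp]
        · simp [mask, hp, hWW p hp]
      simp only [this]) ht
  refine (le_of_eq ?_).trans h
  congr 1
  ext W
  have e : u' ⬝ᵥ (Matrix.of W *ᵥ (M (mask (Matrix.of W) i) *ᵥ v)) =
      u ⬝ᵥ (blk (Matrix.of W) i *ᵥ (M (mask (Matrix.of W) i) *ᵥ v)) := by
    simp [dotProduct, mulVec, blk, u', Fintype.sum_prod_type]
  rw [Set.mem_ofPred_eq, Set.mem_ofPred_eq, e]

lemma stdGaussian_not_opLe_noise {t : ℝ} (ht : 0 ≤ t) :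
    stdGaussian (Fin n × Fin d) (Fin m) {W | ¬ OpLe (Matrix.of W) (4 * t)} ≤
      ENNReal.ofReal (5 ^ (n * d + m) * Real.exp (-t ^ 2 / 2)) := by
  have h := measure_not_opLe_le (μ := stdGaussian (Fin n × Fin d) (Fin m))
    (G := fun W => Matrix.of W) (M := fun _ => (1 : Matrix (Fin m) (Fin m) ℝ)) ht
    fun u hu v => by simpa using stdGaussian_bilin_tail hu v ht
  simp only [Fintype.card_prod, Fintype.card_fin, Matrix.mul_one] at h
  refine (measure_mono fun W hW => ?_).trans h
  exact ⟨1, opLe_one, by rwa [one_mul]⟩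

lemma stdGaussian_not_opLe_blk (i : Fin n)
    {M : Matrix (Fin n × Fin d) (Fin m) ℝ → Matrix (Fin m) (Fin k) ℝ}
    (hM : ∀ a b, Measurable fun W : Fin n × Fin d → Fin m → ℝ => M (mask (Matrix.of W) i) a b)
    {t : ℝ} (ht : 0 ≤ t) :
    stdGaussian (Fin n × Fin d) (Fin m) {W | ∃ L, OpLe (M (mask (Matrix.of W) i)) L ∧
        ¬ OpLe (blk (Matrix.of W) i * M (mask (Matrix.of W) i)) (4 * (L * t))} ≤
      ENNReal.ofReal (5 ^ (d + k) * Real.exp (-t ^ 2 / 2)) := by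
  have h := measure_not_opLe_le (μ := stdGaussian (Fin n × Fin d) (Fin m))
    (G := fun W => blk (Matrix.of W) i) (M := fun W => M (mask (Matrix.of W) i)) ht
    fun u hu v => blk_bilin_tail i hM ht hu v
  simpa only [Fintype.card_fin] using h

end Events

section Probability

variable {n d m : ℕ} {γ : ℝ}

lemma pow_five_mul_exp_le (N : ℕ) {x y : ℝ} (h : 2 * N + y ≤ x) :
    5 ^ N * Real.exp (-x) ≤ Real.exp (-y) := by
  have h5 : (5 : ℝ) ≤ Real.exp 2 := by
    rw [show (2 : ℝ) = 1 + 1 by norm_num, Real.exp_add]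
    nlinarith [Real.exp_one_gt_d9]
  calc (5 : ℝ) ^ N * Real.exp (-x) ≤ Real.exp 2 ^ N * Real.exp (-x) := by gcongr
    _ = Real.exp (2 * N - x) := by
      rw [← Real.exp_nat_mul, ← Real.exp_add]; ring_nf
    _ ≤ Real.exp (-y) := Real.exp_le_exp.2 (by linarith)

lemma le_bnd1_sq (hn : 1 ≤ n) (hγ : 2 ≤ γ) :
    (n : ℝ) * d + m + 2 * γ * n * Real.log n ≤ bnd1 n d m γ ^ 2 := by
  have hlog : 0 ≤ Real.log n := Real.log_natCast_nonneg n
  have h1 := Real.sq_sqrt (show 0 ≤ (n : ℝ) * d by positivity)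
  have h2 := Real.sq_sqrt (show 0 ≤ (m : ℝ) by positivity)
  have h3 := Real.sq_sqrt (show 0 ≤ 2 * γ * n * Real.log n by positivity)
  have p1 := Real.sqrt_nonneg ((n : ℝ) * d)
  have p2 := Real.sqrt_nonneg (m : ℝ)
  have p3 := Real.sqrt_nonneg (2 * γ * n * Real.log n)
  unfold bnd1
  nlinarith [mul_nonneg p1 p2, mul_nonneg p1 p3, mul_nonneg p2 p3]

lemma bnd1_pos (hn : 1 ≤ n) (hd : 1 ≤ d) : 0 < bnd1 n d m γ := by
  have h : 0 < √((n : ℝ) * d) :=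
    Real.sqrt_pos.2 (mul_pos (Nat.cast_pos.2 (by omega)) (Nat.cast_pos.2 (by omega)))
  unfold bnd1
  positivity

lemma rpow_neg_eq_exp (hn : 1 ≤ n) : (n : ℝ) ^ (-γ) = Real.exp (-(γ * Real.log n)) := by
  rw [Real.rpow_def_of_pos (Nat.cast_pos.2 (by omega))]
  ring_nf

lemma noise_failure_le (hn : 1 ≤ n) (hγ : 2 ≤ γ) :
    5 ^ (n * d + m) * Real.exp (-(2 * bnd1 n d m γ) ^ 2 / 2) ≤ (n : ℝ) ^ (-γ) := by
  have h := le_bnd1_sq (d := d) (m := m) hn hγ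
  have hlog : 0 ≤ Real.log n := Real.log_natCast_nonneg n
  have hn1 : (1 : ℝ) ≤ n := by exact_mod_cast hn
  have h2 : 0 ≤ γ * Real.log n := by positivity
  have h3 : γ * Real.log n * 1 ≤ γ * Real.log n * n := mul_le_mul_of_nonneg_left hn1 h2
  rw [rpow_neg_eq_exp hn, neg_div]
  refine pow_five_mul_exp_le _ ?_
  push_cast
  nlinarith

lemma blk_failure_le (hn : 1 ≤ n) (hγ : 2 ≤ γ) :
    5 ^ (d + d) * Real.exp (-(4 * bnd1 n d m γ / √(n : ℝ)) ^ 2 / 2) ≤ (n : ℝ) ^ (-γ) := by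
  have h := le_bnd1_sq (d := d) (m := m) hn hγ
  have hlog : 0 ≤ Real.log n := Real.log_natCast_nonneg n
  have hn0 : (0 : ℝ) < n := Nat.cast_pos.2 (by omega)
  have hm : (0 : ℝ) ≤ m := Nat.cast_nonneg m
  have hd : (0 : ℝ) ≤ d := Nat.cast_nonneg d
  have h2 : 0 ≤ γ * Real.log n := by positivity
  have h3 : (d : ℝ) + 2 * (γ * Real.log n) ≤ bnd1 n d m γ ^ 2 / n := by
    rw [le_div_iff₀ hn0]; linarith
  rw [rpow_neg_eq_exp hn, neg_div, div_pow, Real.sq_sqrt hn0.le]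
  refine pow_five_mul_exp_le _ ?_
  have e : (4 * bnd1 n d m γ) ^ 2 / n / 2 = 8 * (bnd1 n d m γ ^ 2 / n) := by ring
  rw [e]
  push_cast
  linarith

lemma OpLe.mask {W : Matrix (Fin n × Fin d) (Fin m) ℝ} {w : ℝ} (h : OpLe W w) (i : Fin n) :
    OpLe (mask W i) w := by
  refine ⟨h.1, fun v => le_trans (le_of_sq_le (vnorm_nonneg _) ?_) (h.2 v)⟩
  rw [vnorm_sq, vnorm_sq]
  refine Finset.sum_le_sum fun p _ => ?_
  by_cases hp : p.1 = i
  · have : (GOPP.mask W i *ᵥ v) p = 0 := by simp [mulVec, dotProduct, GOPP.mask, hp]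
    rw [this]
    nlinarith [sq_nonneg ((W *ᵥ v) p)]
  · have : (GOPP.mask W i *ᵥ v) p = (W *ᵥ v) p := by simp [mulVec, dotProduct, GOPP.mask, hp]
    rw [this]

/-- The noise events on which the deterministic analysis applies. -/
def GoodNoise (A : Matrix (Fin d) (Fin m) ℝ) (σ a B : ℝ)
    (W : Matrix (Fin n × Fin d) (Fin m) ℝ) : Prop :=
  OpLe W (8 * B) ∧ (∀ i, √(n : ℝ) * frob (blk W i * Aᵀ) ≤ 16 * a * B * √(d : ℝ)) ∧
    ∀ i, ∀ t ≤ n, frob (blk W i * ((mask W i)ᵀ * oracleSeq (dataMat A σ (mask W i)) t)) ≤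
      128 * √(d : ℝ) * B ^ 2

lemma measurable_mask_apply (i : Fin n) (p : Fin n × Fin d) (b : Fin m) :
    Measurable fun W : Fin n × Fin d → Fin m → ℝ => mask (Matrix.of W) i p b := by
  by_cases hp : p.1 = i
  · simp only [mask, of_apply, hp, if_true]; exact measurable_const
  · simp only [mask, of_apply, hp, if_false]
    exact (measurable_pi_apply b).comp (measurable_pi_apply p)

lemma stdGaussian_not_goodNoise_le (A : Matrix (Fin d) (Fin m) ℝ) (σ : ℝ) (hn : 1 ≤ n)
    (hd : 1 ≤ d) (hγ : 2 ≤ γ) :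
    stdGaussian (Fin n × Fin d) (Fin m)
      {W | ¬ GoodNoise A σ (opNorm A) (bnd1 n d m γ) (Matrix.of W)} ≤
      ENNReal.ofReal (400 * (n : ℝ) ^ (-γ + 2)) := by
  set B := bnd1 n d m γ with hBdef
  have hB : 0 < B := bnd1_pos hn hd
  have hn0 : (0 : ℝ) < n := Nat.cast_pos.2 (by omega)
  have hs0 : 0 < √(n : ℝ) := Real.sqrt_pos.2 hn0
  have hs2 : √(n : ℝ) * √(n : ℝ) = n := Real.mul_self_sqrt hn0.le
  set p : ENNReal := ENNReal.ofReal ((n : ℝ) ^ (-γ)) with hp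
  set μ := stdGaussian (Fin n × Fin d) (Fin m) with hμ
  set r : ℝ := 4 * B / √(n : ℝ) with hr
  have hr0 : 0 ≤ r := by positivity
  let M : ℕ → Matrix (Fin n × Fin d) (Fin m) ℝ → Matrix (Fin m) (Fin d) ℝ := fun t X =>
    Xᵀ * oracleSeq (dataMat A σ X) t
  let E₁ : Set (Fin n × Fin d → Fin m → ℝ) := {W | ¬ OpLe (Matrix.of W) (4 * (2 * B))}
  let E₂ : Fin n → Set (Fin n × Fin d → Fin m → ℝ) := fun i =>
    {W | ∃ L, OpLe Aᵀ L ∧ ¬ OpLe (blk (Matrix.of W) i * Aᵀ) (4 * (L * r))}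
  let E₃ : Fin n → ℕ → Set (Fin n × Fin d → Fin m → ℝ) := fun i t =>
    {W | ∃ L, OpLe (M t (mask (Matrix.of W) i)) L ∧
      ¬ OpLe (blk (Matrix.of W) i * M t (mask (Matrix.of W) i)) (4 * (L * r))}
  have h₁ : μ E₁ ≤ p :=
    (stdGaussian_not_opLe_noise (by positivity)).trans
      (ENNReal.ofReal_le_ofReal (noise_failure_le hn hγ))
  have h₂ : ∀ i, μ (E₂ i) ≤ p := fun i =>
    (stdGaussian_not_opLe_blk i (M := fun _ => Aᵀ) (fun _ _ => measurable_const) hr0).trans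
      (ENNReal.ofReal_le_ofReal (blk_failure_le hn hγ))
  have hmeas : ∀ i t a b, Measurable fun W : Fin n × Fin d → Fin m → ℝ =>
      M t (mask (Matrix.of W) i) a b := fun i t => by
    refine measurable_mul_apply (M := fun W : Fin n × Fin d → Fin m → ℝ => (mask (Matrix.of W) i)ᵀ)
      (fun a b => measurable_mask_apply i b a) (measurable_oracleSeq_apply (fun q b => ?_) t)
    simp only [dataMat, Matrix.add_apply, Matrix.smul_apply, smul_eq_mul]
    exact ((measurable_mask_apply i q b).const_mul σ).const_add _
  have h₃ : ∀ i t, μ (E₃ i t) ≤ p := fun i t =>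
    (stdGaussian_not_opLe_blk i (hmeas i t) hr0).trans
      (ENNReal.ofReal_le_ofReal (blk_failure_le hn hγ))
  have hsub : {W : Fin n × Fin d → Fin m → ℝ | ¬ GoodNoise A σ (opNorm A) B (Matrix.of W)} ⊆
      E₁ ∪ ((⋃ i ∈ Finset.univ (α := Fin n), E₂ i) ∪
        ⋃ q ∈ Finset.univ (α := Fin n) ×ˢ Finset.range (n + 1), E₃ q.1 q.2) := by
    intro W hW
    by_contra hcon
    simp only [Set.mem_union, not_or, Set.mem_iUnion, not_exists] at hcon
    obtain ⟨c₁, c₂, c₃⟩ := hcon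
    have g₁ : OpLe (Matrix.of W) (8 * B) := by
      have := not_not.1 c₁
      exact this.mono (by linarith)
    refine hW ⟨g₁, fun i => ?_, fun i t ht => ?_⟩
    · have g₂ : OpLe (blk (Matrix.of W) i * Aᵀ) (4 * (opNorm A * r)) :=
        by_contra fun h => c₂ i (Finset.mem_univ i) ⟨_, (opLe_opNorm A).transpose, h⟩
      have h := mul_le_mul_of_nonneg_left (frob_le_of_opLe g₂) hs0.le
      rw [Fintype.card_fin] at h
      refine h.trans (le_of_eq ?_)
      rw [hr]; field_simp; ring
    · have hM : OpLe (M t (mask (Matrix.of W) i)) (8 * B * √(n : ℝ)) :=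
        (g₁.mask i).transpose.mul (orthBlocks_oracleSeq _ t).opLe
      have g₃ : OpLe (blk (Matrix.of W) i * M t (mask (Matrix.of W) i))
          (4 * (8 * B * √(n : ℝ) * r)) :=
        by_contra fun h => c₃ (i, t) (Finset.mem_product.2 ⟨Finset.mem_univ i,
          Finset.mem_range.2 (by omega)⟩) ⟨_, hM, h⟩
      have h := frob_le_of_opLe g₃
      rw [Fintype.card_fin] at h
      refine h.trans (le_of_eq ?_)
      rw [hr]; field_simp; ring
  have hbound : μ {W | ¬ GoodNoise A σ (opNorm A) B (Matrix.of W)} ≤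
      p + (n * p + (n * (n + 1 : ℕ)) * p) := by
    refine (measure_mono hsub).trans ((measure_union_le _ _).trans (add_le_add h₁
      ((measure_union_le _ _).trans (add_le_add ?_ ?_))))
    · refine (measure_biUnion_finset_le _ _).trans
        ((Finset.sum_le_sum fun i _ => h₂ i).trans (le_of_eq ?_))
      simp
    · refine (measure_biUnion_finset_le _ _).trans
        ((Finset.sum_le_sum fun q _ => h₃ q.1 q.2).trans (le_of_eq ?_))
      simp
  refine hbound.trans ?_
  have hreal : p + (n * p + (n * (n + 1 : ℕ)) * p) =
      ENNReal.ofReal ((1 + n + n * (n + 1)) * (n : ℝ) ^ (-γ)) := by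
    rw [ENNReal.ofReal_mul (by positivity), ← hp,
      ENNReal.ofReal_add (by positivity) (by positivity),
      ENNReal.ofReal_add (by positivity) (by positivity), ENNReal.ofReal_mul (by positivity),
      ENNReal.ofReal_add (by positivity) (by positivity), ENNReal.ofReal_natCast,
      ENNReal.ofReal_one]
    push_cast
    ring
  rw [hreal]
  refine ENNReal.ofReal_le_ofReal ?_
  have hn1 : (1 : ℝ) ≤ n := by exact_mod_cast hn
  rw [Real.rpow_add hn0, Real.rpow_two]
  have hx : 0 ≤ (n : ℝ) ^ (-γ) := by positivity
  have : 1 + (n : ℝ) + n * (n + 1) ≤ 400 * n ^ 2 := by nlinarith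
  nlinarith

end Probability

section Assembly

variable {n d m : ℕ}

lemma regime_of_le {A : Matrix (Fin d) (Fin m) ℝ} {σ B : ℝ} (hn : 1 ≤ n) (hd : 1 ≤ d)
    (hA : 0 < sigmaMin A) (hσ : 0 < σ) (hB : 0 < B)
    (h : σ ≤ 1 / 10000 * (sigmaMin A / kappa A ^ 4) * √(n : ℝ) / (√(d : ℝ) * B)) :
    Regime n d (sigmaMin A) (opNorm A) (kappa A) σ B
      (kappa A ^ 2 / opNorm A * (σ * √(d : ℝ) * B / √(n : ℝ))) := by
  have hn1 : (1 : ℝ) ≤ n := by exact_mod_cast hn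
  have hd1 : (1 : ℝ) ≤ d := by exact_mod_cast hd
  have hsn : 0 < √(n : ℝ) := Real.sqrt_pos.2 (by linarith)
  have hsd : 1 ≤ √(d : ℝ) := Real.one_le_sqrt.2 hd1
  have hsd0 : 0 < √(d : ℝ) := by linarith
  have hn2 : (n : ℝ) = √(n : ℝ) * √(n : ℝ) := (Real.mul_self_sqrt (by linarith)).symm
  have : Nonempty (Fin d) := ⟨⟨0, by omega⟩⟩
  have hκ : 1 ≤ kappa A := (one_le_div hA).2 (sigmaMin_le_opNorm A)
  have ha : opNorm A = kappa A * sigmaMin A := (div_mul_cancel₀ _ hA.ne').symm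
  set s := sigmaMin A
  set κ := kappa A
  have hκ0 : 0 < κ := by linarith
  rw [ha]
  have hτ : κ ^ 2 / (κ * s) * (σ * √(d : ℝ) * B / √(n : ℝ)) =
      κ * (σ * √(d : ℝ) * B / (s * √(n : ℝ))) := by field_simp
  rw [hτ]
  have hβ : κ ^ 4 * (σ * √(d : ℝ) * B / (s * √(n : ℝ))) ≤ 1 / 10000 := by
    rw [le_div_iff₀ (by positivity)] at h
    have h' := mul_le_mul_of_nonneg_left h (show 0 ≤ κ ^ 4 / (s * √(n : ℝ)) by positivity)
    calc κ ^ 4 * (σ * √(d : ℝ) * B / (s * √(n : ℝ)))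
        = κ ^ 4 / (s * √(n : ℝ)) * (σ * (√(d : ℝ) * B)) := by ring
      _ ≤ _ := h'
      _ = 1 / 10000 := by field_simp
  set β := σ * √(d : ℝ) * B / (s * √(n : ℝ)) with hβdef
  have hβ0 : 0 < β := by positivity
  have hmul : σ * √(d : ℝ) * B = β * (s * √(n : ℝ)) := by rw [hβdef]; field_simp
  have hβ1 : β ≤ 1 / 10000 := by
    have := mul_le_mul_of_nonneg_right (one_le_pow₀ (n := 4) hκ) hβ0.le
    linarith
  refine ⟨hn1, hd1, hA, hκ, rfl, hσ, hB, by positivity, ?_, ?_, ?_⟩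
  · calc σ * √(n : ℝ) * (κ * s) * B * √(d : ℝ)
        = √(n : ℝ) * (κ * s) * (σ * √(d : ℝ) * B) := by ring
      _ = κ * β * (√(n : ℝ) * √(n : ℝ) * s ^ 2) := by rw [hmul]; ring
      _ = κ * β * (n * s ^ 2) := by rw [← hn2]
  · have h1 : σ * B ≤ β * (s * √(n : ℝ)) := by
      rw [← hmul]; nlinarith [mul_pos hσ hB]
    have h2 : σ ^ 2 * B ^ 2 * √(d : ℝ) ≤ β * (s * √(n : ℝ)) * (β * (s * √(n : ℝ))) := by
      calc σ ^ 2 * B ^ 2 * √(d : ℝ) = σ * B * (σ * √(d : ℝ) * B) := by ring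
        _ ≤ _ := by rw [hmul]; gcongr
    have h3 : β * (s * √(n : ℝ)) * (β * (s * √(n : ℝ))) = β * β * (n * s ^ 2) := by
      calc β * (s * √(n : ℝ)) * (β * (s * √(n : ℝ)))
          = β * β * (√(n : ℝ) * √(n : ℝ) * s ^ 2) := by ring
        _ = β * β * (n * s ^ 2) := by rw [← hn2]
    rw [h3] at h2
    refine h2.trans ?_
    have h4 : 0 ≤ (n : ℝ) * s ^ 2 := by positivity
    have h5 : β * β ≤ κ * β / 10000 := by nlinarith
    nlinarith [mul_le_mul_of_nonneg_right h5 h4]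
  · have h1 : κ ^ 2 * (κ * β) ≤ κ ^ 4 * β := by
      have := pow_le_pow_right₀ hκ (show 3 ≤ 4 by norm_num)
      nlinarith
    linarith

lemma gpm_limit_blockwise_of_goodNoise {A : Matrix (Fin d) (Fin m) ℝ}
    {W : Matrix (Fin n × Fin d) (Fin m) ℝ} {κ σ B τ : ℝ}
    (hR : Regime n d (sigmaMin A) (opNorm A) κ σ B τ)
    (hW : GoodNoise A σ (opNorm A) B W) {S : ℕ → Matrix (Fin n × Fin d) (Fin d) ℝ}
    (hS : IsGPM (dataMat A σ W) S) {Sinf : Matrix (Fin n × Fin d) (Fin d) ℝ}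
    (hlim : Tendsto (fun t => dF (S t) Sinf) atTop (nhds 0)) :
    ∃ Q : Matrix (Fin d) (Fin d) ℝ, IsOrth Q ∧ ∀ i, frob (blk Sinf i - Q) ≤ 400 * τ := by
  obtain ⟨⟨U, hU, hS₀⟩, hstep⟩ := hS
  have hN : NoiseBound A W (sigmaMin A) (opNorm A) B :=
    ⟨sigmaMin_le A, opLe_opNorm A, hW.1, hW.2.1⟩
  obtain ⟨Q₀, hQ₀, hinit⟩ := spectral_init hR hN hU hS₀
  exact limit_blockwise_le hR hN hW.2.2 hS₀.orthBlocks hstep hQ₀ hinit hlim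

end Assembly

/-- Theorem 3.3, first bound: blockwise Frobenius error bound for the GPM limit. -/
theorem gpm_limit_blockwise_error :
    ∃ c C : ℝ, 0 < c ∧ 0 < C ∧
      ∀ (n d m : ℕ), 1 ≤ n → 1 ≤ d → d ≤ m →
      ∀ A : Matrix (Fin d) (Fin m) ℝ, 0 < sigmaMin A →
      ∀ σ γ : ℝ, 0 < σ → 2 ≤ γ →
      σ ≤ c * (sigmaMin A / kappa A ^ 4) * Real.sqrt (n : ℝ) /
        (Real.sqrt (d : ℝ) * bnd1 n d m γ) →
      ENNReal.ofReal (1 - C * (n : ℝ) ^ (-γ + 2)) ≤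
        stdGaussian (Fin n × Fin d) (Fin m) {W |
          ∀ S : ℕ → Matrix (Fin n × Fin d) (Fin d) ℝ,
            IsGPM (ZStack n d * A + σ • Matrix.of W) S →
          ∀ Sinf, OrthBlocks Sinf →
            Tendsto (fun t => dF (S t) Sinf) atTop (nhds 0) →
            ∃ Q, IsOrth Q ∧ ∀ i, frob (blk Sinf i - Q) ≤
              C * (kappa A ^ 2 / opNorm A) *
                (σ * Real.sqrt (d : ℝ) * bnd1 n d m γ / Real.sqrt (n : ℝ))} := by
  refine ⟨1 / 10000, 400, by norm_num, by norm_num,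
    fun n d m hn hd _ A hA σ γ hσ hγ h => ?_⟩
  have hR := regime_of_le hn hd hA hσ (bnd1_pos hn hd) h
  rw [ENNReal.ofReal_sub _ (by positivity), ENNReal.ofReal_one, tsub_le_iff_right]
  refine le_trans ?_ (add_le_add_right (stdGaussian_not_goodNoise_le A σ hn hd hγ) _)
  refine le_trans ?_ (measure_union_le _ _)
  rw [← measure_univ (μ := stdGaussian (Fin n × Fin d) (Fin m))]
  refine measure_mono fun W _ => ?_
  by_cases hW : GoodNoise A σ (opNorm A) (bnd1 n d m γ) (Matrix.of W)
  · refine Or.inl fun S hS Sinf _ hlim => ?_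
    simp only [mul_assoc (400 : ℝ)]
    exact gpm_limit_blockwise_of_goodNoise hR hW hS hlim
  · exact Or.inr hW

end GOPP
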